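/- arXiv:math/0312204 — 4 statements merged into one kernel-verified Lean document; each statement's English description precedes it below -/
import Mathlib

section
/- Let Σ = ∂K be the boundary of a compact convex body K ⊂ ℝ^d (d ≥ 2) with smooth boundary, and suppose Σ is of finite type. Let Φ be the cap function of Σ on S^{d−1}. Then for every 0 < p ≤ 2, ∫_{S^{d−1}} Φ(θ)^p dθ < ∞, i.e. Φ ∈ L^p(S^{d−1}). -/
open MeasureTheory Set
open scoped RealInnerProductSpace ENNReal

noncomputable section

abbrev Euc (d : ℕ) := EuclideanSpace ℝ (Fin d)

/-- `K` is a compact convex body in `ℝ^d` with nonempty interior and smooth boundary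
`Σ = ∂K`, described by the smooth defining function `F`: `K = {F ≤ 0}`,
`∂K = {F = 0}`, and `∇F ≠ 0` on `∂K`. -/
def SmoothBody (d : ℕ) (K : Set (Euc d)) (F : Euc d → ℝ) : Prop :=
  IsCompact K ∧ Convex ℝ K ∧ (interior K).Nonempty ∧
    ContDiff ℝ (⊤ : ℕ∞) F ∧ K = {x | F x ≤ 0} ∧ frontier K = {x | F x = 0} ∧
    ∀ ζ ∈ frontier K, gradient F ζ ≠ 0

/-- `Σ = ∂K` is of finite type `k`: every tangent line makes contact of order at most
`k` with `Σ`, expressed via the defining function `F`. -/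
def FiniteTypeOrd (d k : ℕ) (K : Set (Euc d)) (F : Euc d → ℝ) : Prop :=
  ∀ ζ ∈ frontier K, ∀ v : Euc d, v ≠ 0 → ⟪gradient F ζ, v⟫ = 0 →
    ∃ j : ℕ, 2 ≤ j ∧ j ≤ k ∧ iteratedDeriv j (fun s : ℝ => F (ζ + s • v)) 0 ≠ 0

/-- The outer unit normal `n(ζ) = ∇F(ζ)/|∇F(ζ)|`. -/
def nrml (d : ℕ) (F : Euc d → ℝ) (ζ : Euc d) : Euc d :=
  ‖gradient F ζ‖⁻¹ • gradient F ζ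

/-- The cap `B(ζ,s) = {ξ ∈ Σ : |⟨n(ζ), ξ − ζ⟩| < s}`. -/
def cap (d : ℕ) (K : Set (Euc d)) (F : Euc d → ℝ) (ζ : Euc d) (s : ℝ) : Set (Euc d) :=
  {ξ | ξ ∈ frontier K ∧ |⟪nrml d F ζ, ξ - ζ⟫| < s}

/-- `Σ = ∂K` is of finite type: every tangent line makes finite order of contact. -/
def FiniteTypeAny (d : ℕ) (K : Set (Euc d)) (F : Euc d → ℝ) : Prop :=
  ∀ ζ ∈ frontier K, ∀ v : Euc d, v ≠ 0 → ⟪gradient F ζ, v⟫ = 0 →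
    ∃ j : ℕ, 2 ≤ j ∧ iteratedDeriv j (fun s : ℝ => F (ζ + s • v)) 0 ≠ 0

/-- The cap function `Φ(θ) = sup_{r>0} σ[B(ξ(θ), 1/r)] (1+r)^{(d−1)/2}`. -/
def capFn (d : ℕ) (K : Set (Euc d)) (F : Euc d → ℝ) (xi : Euc d → Euc d)
    (θ : Euc d) : ℝ :=
  sSup {A : ℝ | ∃ r : ℝ, 0 < r ∧
    A = (μH[(d : ℝ) - 1] (cap d K F (xi θ) (1 / r))).toReal * (1 + r) ^ (((d : ℝ) - 1) / 2)}

theorem exists_bound_coeff (m : ℕ) : ∃ C : ℝ, 0 < C ∧ ∀ (p : Fin (m + 1) → ℝ) (b : ℝ),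
    (∀ s ∈ Icc (0 : ℝ) 1, |∑ j, p j * s ^ (j : ℕ)| ≤ b) → ∀ j, |p j| ≤ C * b := by
  set x : Fin (m + 1) → ℝ := fun i => (i : ℝ) / (m + 1) with hx
  have hm : (0 : ℝ) < m + 1 := by positivity
  have hxinj : Function.Injective x := by
    intro i j hij
    have : (i : ℝ) = (j : ℝ) := by
      simpa [hx, div_left_inj' hm.ne'] using hij
    exact Fin.ext (by exact_mod_cast this)
  have hdet : (Matrix.vandermonde x).det ≠ 0 := Matrix.det_vandermonde_ne_zero_iff.2 hxinj
  have hker : (Matrix.vandermonde x).mulVecLin.ker = ⊥ := by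
    rw [LinearMap.ker_eq_bot']
    intro p hp
    exact Matrix.eq_zero_of_mulVec_eq_zero hdet hp
  obtain ⟨C, hC, hanti⟩ := LinearMap.exists_antilipschitzWith _ hker
  refine ⟨C, by exact_mod_cast hC, fun p b hb j => ?_⟩
  have h1 : ‖p‖ ≤ C * ‖(Matrix.vandermonde x).mulVecLin p‖ := by
    have := hanti.le_mul_dist p 0
    simpa using this
  have hb0 : 0 ≤ b := (abs_nonneg _).trans (hb 0 (by simp))
  have h2 : ‖(Matrix.vandermonde x).mulVecLin p‖ ≤ b := by
    rw [pi_norm_le_iff_of_nonneg hb0]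
    intro i
    have hi : (i : ℝ) ≤ m + 1 := by
      have := i.2.le
      exact_mod_cast this
    have := hb (x i) ⟨by positivity, by rw [hx]; exact (div_le_one hm).2 hi⟩
    simpa [Matrix.mulVec, dotProduct, Matrix.vandermonde_apply, mul_comm] using this
  calc |p j| ≤ ‖p‖ := by simpa using norm_le_pi_norm p j
    _ ≤ _ := h1.trans (by gcongr)

open scoped MatrixOrder Matrix.Norms.L2Operator in
theorem addHaar_quadratic_sublevel {H : Type*} [NormedAddCommGroup H] [InnerProductSpace ℝ H]
    [FiniteDimensional ℝ H] [MeasurableSpace H] [BorelSpace H] (μ : Measure H)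
    [μ.IsAddHaarMeasure] {A : H →ₗ[ℝ] H} (hA : A.IsPositive) (hdet : LinearMap.det A ≠ 0)
    {ε : ℝ} (hε : 0 ≤ ε) :
    μ {k | ⟪A k, k⟫ ≤ ε} =
      ENNReal.ofReal ((√(LinearMap.det A))⁻¹ * (√ε) ^ Module.finrank ℝ H) *
        μ (Metric.ball 0 1) := by
  classical
  let b := stdOrthonormalBasis ℝ H
  have hM := (LinearMap.posSemidef_toMatrix_iff b).2 hA
  obtain ⟨B, hB⟩ := CStarAlgebra.nonneg_iff_eq_star_mul_self.mp hM.nonneg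
  set S : H →ₗ[ℝ] H := Matrix.toLin b.toBasis b.toBasis B with hS
  have hSB : LinearMap.toMatrix b.toBasis b.toBasis S = B := by simp [hS]
  have hAS : A = S.adjoint ∘ₗ S := by
    apply (LinearMap.toMatrix b.toBasis b.toBasis).injective
    rw [hB, LinearMap.toMatrix_comp b.toBasis b.toBasis b.toBasis, LinearMap.toMatrix_adjoint, hSB]
    rfl
  have hinner : ∀ k, ⟪A k, k⟫ = ‖S k‖ ^ 2 := by
    intro k
    rw [hAS, LinearMap.comp_apply, LinearMap.adjoint_inner_left, real_inner_self_eq_norm_sq]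
  have hdetS : LinearMap.det A = LinearMap.det S ^ 2 := by
    rw [← LinearMap.det_toMatrix b.toBasis A, ← LinearMap.det_toMatrix b.toBasis S, hB, hSB,
      Matrix.det_mul, Matrix.star_eq_conjTranspose, Matrix.det_conjTranspose]
    simp [sq]
  have hS0 : LinearMap.det S ≠ 0 := by
    intro h; apply hdet; rw [hdetS, h]; simp
  have hset : {k | ⟪A k, k⟫ ≤ ε} = S ⁻¹' Metric.closedBall 0 (√ε) := by
    ext k
    simp only [mem_ofPred_eq, mem_preimage, mem_closedBall_zero_iff, hinner]
    rw [Real.le_sqrt (norm_nonneg _) hε]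
  rw [hset, Measure.addHaar_preimage_linearMap μ hS0, Measure.addHaar_closedBall μ _ (by positivity),
    ← mul_assoc, ← ENNReal.ofReal_mul (abs_nonneg _), hdetS, Real.sqrt_sq_eq_abs, abs_inv]

section Line

variable {E : Type*} [NormedAddCommGroup E] [NormedSpace ℝ E] {F : E → ℝ}

theorem iteratedDeriv_comp_line (hF : ContDiff ℝ (⊤ : ℕ∞) F) (j : ℕ) (x v : E) (s : ℝ) :
    iteratedDeriv j (fun s : ℝ => F (x + s • v)) s
      = iteratedFDeriv ℝ j F (x + s • v) (fun _ => v) := by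
  have hG : ContDiff ℝ (⊤ : ℕ∞) (fun z => F (x + z)) := hF.comp (contDiff_const.add contDiff_id)
  have := (ContinuousLinearMap.toSpanSingleton ℝ v).iteratedFDeriv_comp_right hG s (i := j)
    (by exact_mod_cast le_top)
  rw [iteratedDeriv_eq_iteratedFDeriv]
  have h2 : (fun s : ℝ => F (x + s • v)) =
      (fun z => F (x + z)) ∘ (ContinuousLinearMap.toSpanSingleton ℝ v) := by
    ext s; simp
  rw [h2, this, iteratedFDeriv_comp_add_left]
  simp

theorem continuous_iteratedFDeriv_diag (hF : ContDiff ℝ (⊤ : ℕ∞) F) (j : ℕ) :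
    Continuous fun q : E × E => iteratedFDeriv ℝ j F q.1 (fun _ => q.2) := by
  have h := hF.continuous_iteratedFDeriv (m := j) (by exact_mod_cast le_top)
  exact (h.comp continuous_fst).eval (continuous_pi fun _ => continuous_snd)

theorem exists_taylor_line (hF : ContDiff ℝ (⊤ : ℕ∞) F) {m : ℕ} (hm : m ≠ 0) (x v : E) {s : ℝ}
    (hs : 0 ≤ s) : ∃ s' ∈ Icc 0 s, F (x + s • v) =
      ∑ j : Fin m, iteratedFDeriv ℝ j F x (fun _ => v) * s ^ (j : ℕ) / (j : ℕ).factorial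
        + iteratedFDeriv ℝ m F (x + s' • v) (fun _ => v) * s ^ m / m.factorial := by
  obtain ⟨n, rfl⟩ := Nat.exists_eq_succ_of_ne_zero hm
  rcases hs.eq_or_lt with rfl | hs
  · refine ⟨0, by simp, ?_⟩
    rw [Fin.sum_univ_succ]
    simp only [zero_smul, add_zero, Fin.val_zero, pow_zero, Nat.factorial_zero, Fin.val_succ]
    simp
    exact (iteratedFDeriv_zero_apply _).symm
  set f : ℝ → ℝ := fun s => F (x + s • v) with hf
  have hfs : ContDiff ℝ (⊤ : ℕ∞) f := hF.comp (by fun_prop)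
  obtain ⟨s', hs', h⟩ := taylor_mean_remainder_lagrange_iteratedDeriv (f := f) (n := n) hs.ne
    ((hfs.of_le (by exact_mod_cast le_top)).contDiffOn)
  rw [uIoo_of_le hs.le] at hs'
  refine ⟨s', ⟨hs'.1.le, hs'.2.le⟩, ?_⟩
  have hf0 : F (x + s • v) = f s := rfl
  rw [hf0, ← sub_eq_iff_eq_add', ← iteratedDeriv_comp_line hF, Nat.succ_eq_add_one]
  rw [sub_zero] at h
  rw [← h, taylor_within_apply, Finset.sum_range]
  congr 1
  refine Finset.sum_congr rfl fun j _ => ?_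
  have h1 : iteratedDerivWithin j f (uIcc 0 s) 0 = iteratedDeriv j f 0 := by
    apply iteratedDerivWithin_eq_iteratedDeriv (by rw [uIcc_of_le hs.le]; exact uniqueDiffOn_Icc hs)
    · exact (hfs.of_le (by exact_mod_cast le_top)).contDiffAt
    · simp
  rw [h1, iteratedDeriv_comp_line hF]
  simp
  field_simp

theorem eventually_quadratic_le (hF : ContDiff ℝ (⊤ : ℕ∞) F) {m : ℕ} (hm : 2 ≤ m) {x₀ v₀ : E}
    (h0 : iteratedFDeriv ℝ m F x₀ (fun _ => v₀) ≠ 0) :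
    ∃ c > 0, ∃ r > 0, ∀ᶠ q in nhds (x₀, v₀), ∀ t ∈ Ioc (0 : ℝ) r, ∀ b : ℝ,
      (∀ s ∈ Icc (0 : ℝ) 1, |F (q.1 + (s * t) • q.2)| ≤ b) →
        c * (|iteratedFDeriv ℝ 2 F q.1 (fun _ => q.2)| * t ^ 2) ≤ b := by
  obtain ⟨C, hC, hcoeff⟩ := exists_bound_coeff m
  set a : E × E → ℝ := fun q => iteratedFDeriv ℝ m F q.1 (fun _ => q.2) with ha
  have hac : Continuous a := continuous_iteratedFDeriv_diag hF m
  set η := |a (x₀, v₀)| with hη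
  have hηpos : 0 < η := abs_pos.2 h0
  set ω := min (η / 2) (η / (4 * C)) with hω
  have hωpos : 0 < ω := by positivity
  have hCω : C * ω ≤ η / 4 := by
    calc C * ω ≤ C * (η / (4 * C)) := by gcongr; exact min_le_right _ _
      _ = η / 4 := by field_simp
  have hcont : Continuous fun z : (E × E) × ℝ => a (z.1.1 + z.2 • z.1.2, z.1.2) :=
    hac.comp (by fun_prop)
  have hnear : ∀ᶠ z in nhds ((x₀, v₀), (0 : ℝ)),
      |a (z.1.1 + z.2 • z.1.2, z.1.2) - a (x₀, v₀)| < ω / 2 := by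
    have := (hcont.tendsto ((x₀, v₀), (0 : ℝ))).eventually (Metric.ball_mem_nhds _ (half_pos hωpos))
    simpa [Real.dist_eq] using this
  rw [nhds_prod_eq] at hnear
  obtain ⟨P, hP, R, hR, hPR⟩ := Filter.eventually_prod_iff.1 hnear
  obtain ⟨r, hr, hrR⟩ := Metric.eventually_nhds_iff.1 hR
  refine ⟨1 / (4 * C), by positivity, r / 2, by positivity, ?_⟩
  filter_upwards [hP] with q hq t ht b hb
  have hnr : ∀ s ∈ Icc (0 : ℝ) t, |a (q.1 + s • q.2, q.2) - a (x₀, v₀)| < ω / 2 := by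
    intro s hs
    refine hPR hq (hrR ?_)
    rw [Real.dist_eq, sub_zero, abs_of_nonneg hs.1]
    linarith [hs.2, ht.2]
  have hn0 : |a q - a (x₀, v₀)| < ω / 2 := by simpa using hnr 0 ⟨le_rfl, ht.1.le⟩
  have haq : η / 2 ≤ |a q| := by
    have h1 : η ≤ |a q| + |a q - a (x₀, v₀)| := by
      rw [hη, abs_sub_comm]
      calc |a (x₀, v₀)| = |a q + (a (x₀, v₀) - a q)| := by ring_nf
        _ ≤ _ := abs_add_le _ _
    have : ω ≤ η / 2 := min_le_left _ _
    linarith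
  set T : ℝ := t ^ m / m.factorial with hT
  have hTpos : 0 < T := by have := ht.1; positivity
  set p : Fin (m + 1) → ℝ := fun j =>
    iteratedFDeriv ℝ j F q.1 (fun _ => q.2) * t ^ (j : ℕ) / (j : ℕ).factorial with hp
  have hpb : ∀ s ∈ Icc (0 : ℝ) 1, |∑ j, p j * s ^ (j : ℕ)| ≤ b + ω * T := by
    intro s hs
    have hst : 0 ≤ s * t := mul_nonneg hs.1 ht.1.le
    have hstt : s * t ≤ t := mul_le_of_le_one_left ht.1.le hs.2
    obtain ⟨s', hs', h⟩ := exists_taylor_line hF (by omega : m ≠ 0) q.1 q.2 hst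
    have h1 : ∑ j, p j * s ^ (j : ℕ) = F (q.1 + (s * t) • q.2)
        - (a (q.1 + s' • q.2, q.2) - a q) * (s ^ m * T) := by
      rw [h, Fin.sum_univ_castSucc]
      simp only [hp, ha, hT, Fin.val_castSucc, Fin.val_last, mul_pow]
      rw [Finset.sum_congr rfl fun (j : Fin m) _ => (by ring :
        iteratedFDeriv ℝ j F q.1 (fun _ => q.2) * t ^ (j : ℕ) / (j : ℕ).factorial * s ^ (j : ℕ)
        = iteratedFDeriv ℝ j F q.1 (fun _ => q.2) * (s ^ (j : ℕ) * t ^ (j : ℕ))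
          / (j : ℕ).factorial)]
      ring
    have h2 : |a (q.1 + s' • q.2, q.2) - a q| ≤ ω := by
      have e1 := hnr s' ⟨hs'.1, hs'.2.trans hstt⟩
      have := abs_sub_le (a (q.1 + s' • q.2, q.2)) (a (x₀, v₀)) (a q)
      rw [abs_sub_comm (a (x₀, v₀))] at this
      linarith
    rw [h1]
    calc _ ≤ |F (q.1 + (s * t) • q.2)| + |(a (q.1 + s' • q.2, q.2) - a q) * (s ^ m * T)| :=
          abs_sub _ _
      _ ≤ b + ω * T := by
        gcongr
        · exact hb s hs
        · rw [abs_mul]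
          gcongr
          rw [abs_of_nonneg (mul_nonneg (pow_nonneg hs.1 _) hTpos.le)]
          exact mul_le_of_le_one_left hTpos.le (pow_le_one₀ hs.1 hs.2)
  have hm' := hcoeff p _ hpb (Fin.last m)
  have h2' := hcoeff p _ hpb ⟨2, by omega⟩
  have e1 : |p (Fin.last m)| = |a q| * T := by
    simp only [hp, ha, hT, Fin.val_last]
    rw [mul_div_assoc, abs_mul, abs_of_pos hTpos]
  have e2 : |p ⟨2, by omega⟩| = |iteratedFDeriv ℝ 2 F q.1 (fun _ => q.2)| * t ^ 2 / 2 := by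
    simp only [hp]
    rw [abs_div, abs_mul, abs_of_nonneg (sq_nonneg t)]
    simp
  rw [e1] at hm'
  rw [e2] at h2'
  have k1 : η / 4 * T ≤ C * b := by nlinarith
  have k2 : C * ω * T ≤ C * b := by nlinarith
  rw [one_div, inv_mul_le_iff₀ (by positivity)]
  nlinarith

theorem exists_quadratic_le_of_isCompact (hF : ContDiff ℝ (⊤ : ℕ∞) F) {Z : Set (E × E)}
    (hZ : IsCompact Z)
    (hfin : ∀ q ∈ Z, ∃ m, 2 ≤ m ∧ iteratedFDeriv ℝ m F q.1 (fun _ => q.2) ≠ 0) :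
    ∃ c > 0, ∃ r > 0, ∀ q ∈ Z, ∀ t ∈ Ioc (0 : ℝ) r, ∀ b : ℝ,
      (∀ s ∈ Icc (0 : ℝ) 1, |F (q.1 + (s * t) • q.2)| ≤ b) →
        c * (|iteratedFDeriv ℝ 2 F q.1 (fun _ => q.2)| * t ^ 2) ≤ b := by
  refine hZ.induction_on (p := fun Z => ∃ c > 0, ∃ r > 0, ∀ q ∈ Z, ∀ t ∈ Ioc (0 : ℝ) r, ∀ b : ℝ,
      (∀ s ∈ Icc (0 : ℝ) 1, |F (q.1 + (s * t) • q.2)| ≤ b) →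
        c * (|iteratedFDeriv ℝ 2 F q.1 (fun _ => q.2)| * t ^ 2) ≤ b) ?_ ?_ ?_ ?_
  · exact ⟨1, one_pos, 1, one_pos, by simp⟩
  · rintro s t hst ⟨c, hc, r, hr, h⟩
    exact ⟨c, hc, r, hr, fun q hq => h q (hst hq)⟩
  · rintro s t ⟨c, hc, r, hr, h⟩ ⟨c', hc', r', hr', h'⟩
    refine ⟨min c c', by positivity, min r r', by positivity, ?_⟩
    rintro q (hq | hq) t ht b hb
    · refine le_trans ?_ (h q hq t ⟨ht.1, ht.2.trans (min_le_left _ _)⟩ b hb)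
      gcongr
      exact min_le_left _ _
    · refine le_trans ?_ (h' q hq t ⟨ht.1, ht.2.trans (min_le_right _ _)⟩ b hb)
      gcongr
      exact min_le_right _ _
  · rintro ⟨x, v⟩ hq
    obtain ⟨m, hm, h0⟩ := hfin _ hq
    obtain ⟨c, hc, r, hr, h⟩ := eventually_quadratic_le hF hm h0
    exact ⟨_, mem_nhdsWithin_of_mem_nhds h, c, hc, r, hr, fun q hq => hq⟩

end Line

section Body

variable {d : ℕ} {K : Set (Euc d)} {F : Euc d → ℝ}

theorem SmoothBody.contDiff (hK : SmoothBody d K F) : ContDiff ℝ (⊤ : ℕ∞) F := hK.2.2.2.1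

theorem SmoothBody.mem_iff (hK : SmoothBody d K F) {x : Euc d} : x ∈ K ↔ F x ≤ 0 := by
  rw [hK.2.2.2.2.1]; rfl

theorem SmoothBody.mem_frontier_iff (hK : SmoothBody d K F) {x : Euc d} :
    x ∈ frontier K ↔ F x = 0 := by
  rw [hK.2.2.2.2.2.1]; rfl

theorem SmoothBody.isCompact_frontier (hK : SmoothBody d K F) : IsCompact (frontier K) :=
  hK.1.of_isClosed_subset isClosed_frontier hK.1.isClosed.frontier_subset

theorem SmoothBody.differentiable (hK : SmoothBody d K F) : Differentiable ℝ F :=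
  hK.contDiff.differentiable (by simp)

theorem SmoothBody.hasDerivAt_line (hK : SmoothBody d K F) (x v : Euc d) (t : ℝ) :
    HasDerivAt (fun s : ℝ => F (x + s • v)) (fderiv ℝ F (x + t • v) v) t := by
  have h1 : HasDerivAt (fun s : ℝ => x + s • v) v t := by
    simpa using ((hasDerivAt_id t).smul_const v).const_add x
  exact (hK.differentiable (x + t • v)).hasFDerivAt.comp_hasDerivAt t h1

theorem SmoothBody.fderiv_sub_nonpos (hK : SmoothBody d K F) {ζ x : Euc d} (hζ : ζ ∈ frontier K)
    (hx : x ∈ K) : fderiv ℝ F ζ (x - ζ) ≤ 0 := by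
  have hd := hK.hasDerivAt_line ζ (x - ζ) 0
  rw [zero_smul, add_zero] at hd
  by_contra! hpos
  have hev := (hd.tendsto_slope_zero_right).eventually (lt_mem_nhds hpos)
  have h01 : ∀ᶠ t : ℝ in nhdsWithin 0 (Ioi 0), t ∈ Ioo (0 : ℝ) 1 := Ioo_mem_nhdsGT one_pos
  obtain ⟨t, ht, ht01⟩ := (hev.and h01).exists
  have hF0 : F ζ = 0 := hK.mem_frontier_iff.1 hζ
  have hmem : ζ + t • (x - ζ) ∈ K :=
    hK.2.1.add_smul_sub_mem (hK.1.isClosed.frontier_subset hζ) hx ⟨ht01.1.le, ht01.2.le⟩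
  have := hK.mem_iff.1 hmem
  simp only [zero_add, zero_smul, add_zero, hF0, sub_zero, smul_eq_mul] at ht
  have h3 := inv_pos.2 ht01.1
  nlinarith

theorem SmoothBody.nonneg_of_tangent (hK : SmoothBody d K F) {ζ v : Euc d} (hζ : ζ ∈ frontier K)
    (hv : fderiv ℝ F ζ v = 0) : 0 ≤ F (ζ + v) := by
  by_contra! hneg
  have hg : gradient F ζ ≠ 0 := hK.2.2.2.2.2.2 ζ hζ
  have hc : Continuous fun ε : ℝ => F (ζ + v + ε • gradient F ζ) :=
    hK.contDiff.continuous.comp (by fun_prop)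
  have hev : ∀ᶠ ε : ℝ in nhds 0, F (ζ + v + ε • gradient F ζ) < 0 :=
    (hc.tendsto 0).eventually (gt_mem_nhds (by simpa using hneg))
  have h0 : ∀ᶠ ε : ℝ in nhdsWithin 0 (Ioi 0), 0 < ε := self_mem_nhdsWithin
  obtain ⟨ε, hε, hεpos⟩ := ((hev.filter_mono nhdsWithin_le_nhds).and h0).exists
  have := hK.fderiv_sub_nonpos hζ (hK.mem_iff.2 hε.le)
  rw [show ζ + v + ε • gradient F ζ - ζ = v + ε • gradient F ζ by abel, map_add, hv, map_smul,
    ← inner_gradient_left, real_inner_self_eq_norm_sq, zero_add, smul_eq_mul] at this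
  have : 0 < ε * ‖gradient F ζ‖ ^ 2 := by positivity
  linarith

theorem SmoothBody.hessian_nonneg (hK : SmoothBody d K F) {ζ v : Euc d} (hζ : ζ ∈ frontier K)
    (hv : fderiv ℝ F ζ v = 0) : 0 ≤ iteratedFDeriv ℝ 2 F ζ (fun _ => v) := by
  set f : ℝ → ℝ := fun s => F (ζ + s • v) with hf
  have hnn : ∀ s, 0 ≤ f s := fun s => hK.nonneg_of_tangent hζ (by rw [map_smul, hv, smul_zero])
  have hf0 : f 0 = 0 := by simpa [hf] using hK.mem_frontier_iff.1 hζ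
  have h2 : iteratedFDeriv ℝ 2 F ζ (fun _ => v) = deriv (deriv f) 0 := by
    have := iteratedDeriv_comp_line hK.contDiff 2 ζ v 0
    rw [zero_smul, add_zero] at this
    rw [← this, iteratedDeriv_succ, iteratedDeriv_one]
  by_contra! hneg
  have hd0 : deriv f 0 = 0 := by
    have := hK.hasDerivAt_line ζ v 0
    rw [zero_smul, add_zero, hv] at this
    exact this.deriv
  have hmax := isLocalMax_of_deriv_deriv_neg (h2 ▸ hneg) hd0
    (hK.hasDerivAt_line ζ v 0).continuousAt
  have hz : f =ᶠ[nhds 0] fun _ => 0 := by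
    filter_upwards [hmax] with s hs
    exact le_antisymm (hs.trans hf0.le) (hnn s)
  rw [h2, hz.deriv.deriv_eq] at hneg
  simp at hneg

theorem SmoothBody.eq_of_tangent (hK : SmoothBody d K F) (hft : FiniteTypeAny d K F) {ζ ξ : Euc d}
    (hζ : ζ ∈ frontier K) (hξ : ξ ∈ K) (h : fderiv ℝ F ζ (ξ - ζ) = 0) : ξ = ζ := by
  by_contra hne
  obtain ⟨j, -, hj⟩ := hft ζ hζ (ξ - ζ) (sub_ne_zero.2 hne) (by rw [inner_gradient_left, h])
  set f : ℝ → ℝ := fun s => F (ζ + s • (ξ - ζ)) with hf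
  have hz : ∀ s ∈ Ioo (0 : ℝ) 1, f s = 0 := by
    intro s hs
    refine le_antisymm (hK.mem_iff.1 ?_)
      (hK.nonneg_of_tangent hζ (by rw [map_smul, h, smul_zero]))
    exact hK.2.1.add_smul_sub_mem (hK.1.isClosed.frontier_subset hζ) hξ ⟨hs.1.le, hs.2.le⟩
  have hzd : ∀ s ∈ Ioo (0 : ℝ) 1, iteratedDeriv j f s = 0 := by
    intro s hs
    have : f =ᶠ[nhds s] fun _ => 0 :=
      Filter.eventually_of_mem (isOpen_Ioo.mem_nhds hs) hz
    rw [this.iteratedDeriv_eq]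
    simp
  have hfs : ContDiff ℝ (⊤ : ℕ∞) f := hK.contDiff.comp (by fun_prop)
  have hc : Continuous (iteratedDeriv j f) :=
    hfs.continuous_iteratedDeriv j (by exact_mod_cast le_top)
  have hev : ∀ᶠ s : ℝ in nhdsWithin 0 (Ioi 0), iteratedDeriv j f s = 0 :=
    Filter.eventually_of_mem (Ioo_mem_nhdsGT one_pos) hzd
  exact hj (tendsto_nhds_unique (hc.tendsto 0 |>.mono_left nhdsWithin_le_nhds)
    (tendsto_const_nhds.congr' (hev.mono fun _ h => h.symm)))

theorem inner_nrml (x v : Euc d) : ⟪nrml d F x, v⟫ = ‖gradient F x‖⁻¹ * fderiv ℝ F x v := by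
  rw [nrml, real_inner_smul_left, inner_gradient_left]

theorem SmoothBody.norm_nrml (hK : SmoothBody d K F) {ζ : Euc d} (hζ : ζ ∈ frontier K) :
    ‖nrml d F ζ‖ = 1 :=
  norm_smul_inv_norm (hK.2.2.2.2.2.2 ζ hζ)

theorem SmoothBody.continuous_gradient (hK : SmoothBody d K F) : Continuous (gradient F) :=
  (InnerProductSpace.toDual ℝ (Euc d)).symm.continuous.comp
    (hK.contDiff.continuous_fderiv (by simp))

theorem SmoothBody.continuousOn_nrml (hK : SmoothBody d K F) :
    ContinuousOn (nrml d F) (frontier K) := fun ζ hζ =>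
  ((hK.continuous_gradient.norm.continuousAt.inv₀
    (norm_ne_zero_iff.2 (hK.2.2.2.2.2.2 ζ hζ))).smul
    hK.continuous_gradient.continuousAt).continuousWithinAt

theorem SmoothBody.eq_of_nrml_eq (hK : SmoothBody d K F) (hft : FiniteTypeAny d K F) {ζ ξ : Euc d}
    (hζ : ζ ∈ frontier K) (hξ : ξ ∈ frontier K) (h : nrml d F ζ = nrml d F ξ) : ζ = ξ := by
  have hζ' := hK.1.isClosed.frontier_subset hζ
  have hξ' := hK.1.isClosed.frontier_subset hξ
  have gζ := inv_pos.2 (norm_pos_iff.2 (hK.2.2.2.2.2.2 ζ hζ))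
  have gξ := inv_pos.2 (norm_pos_iff.2 (hK.2.2.2.2.2.2 ξ hξ))
  have h1 : ⟪nrml d F ζ, ξ - ζ⟫ ≤ 0 := by
    rw [inner_nrml]
    exact mul_nonpos_of_nonneg_of_nonpos gζ.le (hK.fderiv_sub_nonpos hζ hξ')
  have h2 : 0 ≤ ⟪nrml d F ζ, ξ - ζ⟫ := by
    rw [h, ← neg_sub ζ ξ, inner_neg_right, inner_nrml]
    exact neg_nonneg.2 (mul_nonpos_of_nonneg_of_nonpos gξ.le (hK.fderiv_sub_nonpos hξ hζ'))
  have h3 := le_antisymm h1 h2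
  rw [inner_nrml, mul_eq_zero, or_iff_right gζ.ne'] at h3
  exact (hK.eq_of_tangent hft hζ hξ' h3).symm

theorem SmoothBody.exists_cap_subset_ball (hK : SmoothBody d K F) (hft : FiniteTypeAny d K F)
    {ρ : ℝ} (hρ : 0 < ρ) :
    ∃ δ > 0, ∀ ζ ∈ frontier K, cap d K F ζ δ ⊆ Metric.ball ζ ρ := by
  set Z : Set (Euc d × Euc d) := (frontier K ×ˢ frontier K) ∩ {q | ρ ≤ dist q.2 q.1} with hZ
  have hZc : IsCompact Z := (hK.isCompact_frontier.prod hK.isCompact_frontier).inter_right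
    (isClosed_le continuous_const (by fun_prop))
  rcases Z.eq_empty_or_nonempty with he | hne
  · refine ⟨1, one_pos, fun ζ hζ ξ hξ => ?_⟩
    by_contra hfar
    have : (ζ, ξ) ∈ Z := ⟨⟨hζ, hξ.1⟩, by simpa using hfar⟩
    simp [he] at this
  · have hcont : ContinuousOn (fun q : Euc d × Euc d => |⟪nrml d F q.1, q.2 - q.1⟫|) Z := by
      refine ContinuousOn.abs (ContinuousOn.inner (𝕜 := ℝ) ?_ (by fun_prop))
      exact hK.continuousOn_nrml.comp continuousOn_fst fun q hq => hq.1.1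
    obtain ⟨q, hq, hmin⟩ := hZc.exists_isMinOn hne hcont
    refine ⟨_, (abs_pos (a := ⟪nrml d F q.1, q.2 - q.1⟫)).2 fun h0 => ?_, fun ζ hζ ξ hξ => ?_⟩
    · have gq := inv_pos.2 (norm_pos_iff.2 (hK.2.2.2.2.2.2 q.1 hq.1.1))
      rw [inner_nrml, mul_eq_zero, or_iff_right gq.ne'] at h0
      have := hK.eq_of_tangent hft hq.1.1 (hK.1.isClosed.frontier_subset hq.1.2) h0
      have h2 : ρ ≤ dist q.2 q.1 := hq.2
      rw [this, dist_self] at h2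
      linarith
    · by_contra hfar
      have hmem : (ζ, ξ) ∈ Z := ⟨⟨hζ, hξ.1⟩, by simpa using hfar⟩
      have := hmin hmem
      exact absurd hξ.2 (not_lt.2 this)

theorem SmoothBody.exists_hessian_le (hK : SmoothBody d K F) (hft : FiniteTypeAny d K F) :
    ∃ c > 0, ∃ r > 0, ∀ ζ ∈ frontier K, ∀ w : Euc d, fderiv ℝ F ζ w = 0 → ‖w‖ ≤ r → ∀ b : ℝ,
      (∀ s ∈ Icc (0 : ℝ) 1, F (ζ + s • w) ≤ b) →
        c * iteratedFDeriv ℝ 2 F ζ (fun _ => w) ≤ b := by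
  set Z : Set (Euc d × Euc d) := (frontier K ×ˢ Metric.sphere 0 1) ∩ {q | fderiv ℝ F q.1 q.2 = 0}
    with hZ
  have hfc : Continuous fun q : Euc d × Euc d => fderiv ℝ F q.1 q.2 :=
    ((hK.contDiff.continuous_fderiv (by simp)).comp continuous_fst).clm_apply continuous_snd
  have hZc : IsCompact Z := (hK.isCompact_frontier.prod (isCompact_sphere 0 1)).inter_right
    (isClosed_eq hfc continuous_const)
  obtain ⟨c, hc, r, hr, h⟩ := exists_quadratic_le_of_isCompact hK.contDiff hZc (by
    rintro ⟨ζ, v⟩ ⟨⟨hζ, hv⟩, ht⟩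
    obtain ⟨j, hj, h⟩ := hft ζ hζ v (Metric.ne_of_mem_sphere hv one_ne_zero)
      (by rw [inner_gradient_left]; exact ht)
    refine ⟨j, hj, ?_⟩
    rwa [iteratedDeriv_comp_line hK.contDiff, zero_smul, add_zero] at h)
  refine ⟨c, hc, r, hr, fun ζ hζ w hw hwr b hb => ?_⟩
  rcases eq_or_ne w 0 with rfl | hw0
  · have := hb 0 (by simp)
    rw [smul_zero, add_zero, hK.mem_frontier_iff.1 hζ] at this
    rwa [ContinuousMultilinearMap.map_coord_zero _ 0 rfl, mul_zero]
  have hwpos := norm_pos_iff.2 hw0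
  have hwv : w = ‖w‖ • (‖w‖⁻¹ • w) := by rw [smul_smul, mul_inv_cancel₀ hwpos.ne', one_smul]
  have key := h (ζ, ‖w‖⁻¹ • w) ⟨⟨hζ, by simp [norm_smul, hwpos.ne']⟩, by simp [hw]⟩ ‖w‖
    ⟨hwpos, hwr⟩ b (fun s hs => by
      rw [mul_smul, ← hwv, abs_of_nonneg (hK.nonneg_of_tangent hζ (by rw [map_smul, hw, smul_zero]))]
      exact hb s hs)
  have e : iteratedFDeriv ℝ 2 F ζ (fun _ => w) =
      iteratedFDeriv ℝ 2 F ζ (fun _ => ‖w‖⁻¹ • w) * ‖w‖ ^ 2 := by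
    conv_lhs => rw [hwv]
    rw [ContinuousMultilinearMap.map_smul_univ]
    simp [mul_comm]
  rw [e]
  refine le_trans ?_ key
  gcongr
  exact le_abs_self _

end Body

theorem lintegral_image_hausdorffMeasure_le {X Y : Type*} [EMetricSpace X] [MeasurableSpace X]
    [BorelSpace X] [EMetricSpace Y] [MeasurableSpace Y] [BorelSpace Y] {C : NNReal} {N : X → Y}
    (hN : LipschitzWith C N) {r : ℝ} (hr : 0 ≤ r) (s : Set X) (f : Y → ℝ≥0∞) :
    ∫⁻ y in N '' s, f y ∂μH[r] ≤ (C : ℝ≥0∞) ^ r * ∫⁻ x in s, f (N x) ∂μH[r] := by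
  have hle : (μH[r] : Measure Y).restrict (N '' s) ≤
      ((C : ℝ≥0∞) ^ r) • Measure.map N ((μH[r] : Measure X).restrict s) := by
    refine Measure.le_iff.2 fun B hB => ?_
    have hpre : MeasurableSet (N ⁻¹' B) := hN.continuous.measurable hB
    rw [Measure.restrict_apply hB, Measure.smul_apply, Measure.map_apply hN.continuous.measurable hB,
      Measure.restrict_apply hpre, smul_eq_mul, inter_comm B, ← image_inter_preimage,
      inter_comm s]
    exact hN.hausdorffMeasure_image_le hr _
  calc _ ≤ ∫⁻ y, f y ∂(((C : ℝ≥0∞) ^ r) • Measure.map N ((μH[r] : Measure X).restrict s)) :=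
        lintegral_mono' hle le_rfl
    _ = (C : ℝ≥0∞) ^ r * ∫⁻ y, f y ∂(Measure.map N ((μH[r] : Measure X).restrict s)) := by
        rw [lintegral_smul_measure, smul_eq_mul]
    _ ≤ _ := by gcongr; exact lintegral_map_le _ _

section Hyperplane

variable {E : Type*} [NormedAddCommGroup E] [InnerProductSpace ℝ E]

/-- The hyperplane through the origin orthogonal to `ν`. -/
abbrev hyper (ν : E) : Submodule ℝ E := (ℝ ∙ ν)ᗮ

/-- The orthogonal projection onto `hyper ν`. -/
abbrev hproj (ν : E) : E →L[ℝ] hyper ν := (hyper ν).orthogonalProjectionOnto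

theorem coe_hproj {ν : E} (hν : ‖ν‖ = 1) (x : E) : (hproj ν x : E) = x - ⟪ν, x⟫ • ν := by
  have := Submodule.starProjection_orthogonal_val (K := ℝ ∙ ν) x
  rw [← Submodule.starProjection_apply, this, Submodule.starProjection_unit_singleton ℝ hν]

theorem inner_hyper (ν : E) (k : hyper ν) : ⟪ν, (k : E)⟫ = 0 :=
  Submodule.mem_orthogonal_singleton_iff_inner_right.1 k.2

theorem inner_hproj_left (ν x : E) (k : hyper ν) : ⟪hproj ν x, k⟫ = ⟪x, (k : E)⟫ :=
  Submodule.inner_orthogonalProjectionOnto_eq_of_mem_right k x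

/-- The radial projection of the affine hyperplane `ν + hyper ν` to the unit sphere. -/
def radial (ν : E) (y : hyper ν) : E := ‖(y : E) + ν‖⁻¹ • ((y : E) + ν)

theorem one_le_norm_add {ν : E} (hν : ‖ν‖ = 1) (y : hyper ν) : 1 ≤ ‖(y : E) + ν‖ := by
  have h := norm_add_sq_eq_norm_sq_add_norm_sq_real (x := (y : E)) (y := ν)
    (by rw [real_inner_comm, inner_hyper])
  nlinarith [norm_nonneg ((y : E) + ν), norm_nonneg (y : E), mul_self_nonneg ‖(y : E)‖]

theorem lipschitzWith_radial {ν : E} (hν : ‖ν‖ = 1) : LipschitzWith 2 (radial ν) := by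
  refine LipschitzWith.of_dist_le_mul fun y z => ?_
  have ha := one_le_norm_add hν y
  have hb := one_le_norm_add hν z
  have hab : ‖((y : E) + ν) - ((z : E) + ν)‖ = dist y z := by
    rw [add_sub_add_right_eq_sub, dist_eq_norm, ← Submodule.coe_sub, Submodule.coe_norm]
  unfold radial
  set a := (y : E) + ν
  set b := (z : E) + ν
  rw [← hab, dist_eq_norm]
  have ha0 : 0 < ‖a‖ := by linarith
  have hb0 : 0 < ‖b‖ := by linarith
  have h1 : ‖a‖⁻¹ • a - ‖b‖⁻¹ • b = ‖a‖⁻¹ • (a - b) + (‖a‖⁻¹ - ‖b‖⁻¹) • b := by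
    rw [smul_sub, sub_smul]; abel
  have h2 : |‖a‖⁻¹ - ‖b‖⁻¹| * ‖b‖ = ‖a‖⁻¹ * |‖b‖ - ‖a‖| := by
    rw [← abs_of_pos hb0, ← abs_mul, ← abs_of_pos (inv_pos.2 ha0), ← abs_mul, abs_of_pos hb0]
    rw [abs_of_pos (inv_pos.2 ha0)]
    congr 1
    field_simp
  have h3 : |‖b‖ - ‖a‖| ≤ ‖a - b‖ := by
    rw [norm_sub_rev]; exact abs_norm_sub_norm_le _ _
  have h4 : ‖a‖⁻¹ ≤ 1 := inv_le_one_of_one_le₀ ha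
  rw [h1]
  calc _ ≤ ‖‖a‖⁻¹ • (a - b)‖ + ‖(‖a‖⁻¹ - ‖b‖⁻¹) • b‖ := norm_add_le _ _
    _ = ‖a‖⁻¹ * ‖a - b‖ + ‖a‖⁻¹ * |‖b‖ - ‖a‖| := by
      rw [norm_smul, norm_smul, Real.norm_eq_abs, Real.norm_eq_abs, h2, abs_of_pos (inv_pos.2 ha0)]
    _ ≤ 1 * ‖a - b‖ + 1 * ‖a - b‖ := by gcongr
    _ = _ := by push_cast; ring

variable {F : E → ℝ}

/-- The linear map sending `k ∈ hyper ν` to the vector `k + a ν` tangent to the level set of `F`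
at `x`. -/
def tangentLift (F : E → ℝ) (ν x : E) : hyper ν →L[ℝ] E :=
  (hyper ν).subtypeL -
    ((fderiv ℝ F x ν)⁻¹ • (fderiv ℝ F x ∘L (hyper ν).subtypeL)).smulRight ν

theorem tangentLift_apply (ν x : E) (k : hyper ν) :
    tangentLift F ν x k = k - ((fderiv ℝ F x ν)⁻¹ * fderiv ℝ F x k) • ν := by
  simp [tangentLift]

theorem fderiv_tangentLift {ν x : E} (h : fderiv ℝ F x ν ≠ 0) (k : hyper ν) :
    fderiv ℝ F x (tangentLift F ν x k) = 0 := by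
  rw [tangentLift_apply, map_sub, map_smul, smul_eq_mul]
  field_simp
  ring

theorem norm_sub_le_of_level (hF : Differentiable ℝ F) {ν : E} (hν : ‖ν‖ = 1) {B : Set E}
    (hB : Convex ℝ B) {γ L : ℝ} (hγ : 0 < γ) (hγB : ∀ z ∈ B, γ ≤ fderiv ℝ F z ν)
    (hL : ∀ z ∈ B, ‖fderiv ℝ F z‖ ≤ L) {x y : E} (hx : x ∈ B) (hy : y ∈ B) (hxy : F x = F y) :
    ‖x - y‖ ≤ (1 + L / γ) * ‖hproj ν (x - y)‖ := by
  obtain ⟨z, hz, h⟩ := domain_mvt (fun z _ => (hF z).hasFDerivAt.hasFDerivWithinAt) hB hy hx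
  have hzB := hB.segment_subset hy hx hz
  set u := x - y with hu
  have hdec : u = hproj ν u + ⟪ν, u⟫ • ν := by rw [coe_hproj hν]; abel
  rw [hxy, sub_self, hdec, map_add, map_smul, smul_eq_mul] at h
  have hg := hγB z hzB
  have h1 : |⟪ν, u⟫| * γ ≤ L * ‖hproj ν u‖ := by
    calc |⟪ν, u⟫| * γ ≤ |⟪ν, u⟫| * fderiv ℝ F z ν := by gcongr
      _ = |⟪ν, u⟫ * fderiv ℝ F z ν| := by rw [abs_mul, abs_of_pos (hγ.trans_le hg)]
      _ = |fderiv ℝ F z (hproj ν u)| := by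
        rw [← abs_neg]; congr 1; linarith
      _ ≤ ‖fderiv ℝ F z‖ * ‖(hproj ν u : E)‖ := (fderiv ℝ F z).le_opNorm _
      _ ≤ _ := by gcongr; exacts [(norm_nonneg _).trans (hL z hzB), hL z hzB, le_rfl]
  have h2 : |⟪ν, u⟫| ≤ L / γ * ‖hproj ν u‖ := by
    rw [div_mul_eq_mul_div, le_div_iff₀ hγ]; exact h1
  calc ‖u‖ ≤ ‖(hproj ν u : E)‖ + ‖⟪ν, u⟫ • ν‖ := by
        conv_lhs => rw [hdec]
        exact norm_add_le _ _
    _ ≤ ‖hproj ν u‖ + L / γ * ‖hproj ν u‖ := by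
        rw [norm_smul, hν, mul_one, Real.norm_eq_abs]; gcongr; exact le_rfl
    _ = _ := by ring

theorem hasFDerivWithinAt_section (hF : Differentiable ℝ F) {ν : E} (hν : ‖ν‖ = 1)
    {V : Set (hyper ν)} {ψ : hyper ν → E} {C : NNReal} (hψ : LipschitzOnWith C ψ V)
    (hFψ : ∀ h ∈ V, F (ψ h) = 0) (hpr : ∀ h ∈ V, hproj ν (ψ h) = h) {h : hyper ν} (hh : h ∈ V)
    (h0 : fderiv ℝ F (ψ h) ν ≠ 0) :
    HasFDerivWithinAt ψ (tangentLift F ν (ψ h)) V h := by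
  have hO : (fun h' => ψ h' - ψ h) =O[nhdsWithin h V] fun h' => h' - h := by
    refine Asymptotics.IsBigO.of_bound C ?_
    filter_upwards [self_mem_nhdsWithin] with h' hh'
    simpa [dist_eq_norm] using hψ.dist_le_mul _ hh' _ hh
  have ho : (fun h' => F (ψ h') - F (ψ h) - fderiv ℝ F (ψ h) (ψ h' - ψ h)) =o[nhdsWithin h V]
      fun h' => h' - h :=
    (((hF (ψ h)).hasFDerivAt.isLittleO).comp_tendsto (hψ.continuousOn h hh)).trans_isBigO hO
  refine HasFDerivWithinAt.of_isLittleO ?_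
  have hcong : (fun h' => ψ h' - ψ h - tangentLift F ν (ψ h) (h' - h)) =ᶠ[nhdsWithin h V]
      fun h' => (-(F (ψ h') - F (ψ h) - fderiv ℝ F (ψ h) (ψ h' - ψ h))) •
        ((fderiv ℝ F (ψ h) ν)⁻¹ • ν) := by
    filter_upwards [self_mem_nhdsWithin] with h' hh'
    set u := ψ h' - ψ h with hu
    have hk : h' - h = hproj ν u := by rw [hu, map_sub, hpr _ hh', hpr _ hh]
    rw [hFψ _ hh', hFψ _ hh, tangentLift_apply, hk, coe_hproj hν]
    rw [map_sub, map_smul, smul_eq_mul, mul_sub, mul_comm (⟪ν, u⟫), ← mul_assoc,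
      inv_mul_cancel₀ h0, smul_smul, one_mul, sub_smul]
    simp only [sub_self, zero_sub, neg_neg]
    rw [mul_comm]
    abel
  refine Asymptotics.IsLittleO.congr' ?_ hcong.symm (Filter.EventuallyEq.refl _ _)
  set c := (fderiv ℝ F (ψ h) ν)⁻¹ • ν
  have hc : (fun h' => ‖h' - h‖ • c) =O[nhdsWithin h V] fun h' => h' - h :=
    Asymptotics.IsBigO.of_bound ‖c‖ (Filter.Eventually.of_forall fun h' => by
      rw [norm_smul, norm_norm, mul_comm])
  exact (ho.neg_left.norm_right.smul_isBigO
    (Asymptotics.isBigO_refl (fun _ => c) _)).trans_isBigO hc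

variable [FiniteDimensional ℝ E]

/-- The normal direction of the level set of `F` at `x` in gnomonic coordinates around `ν`. -/
def gnomonic (F : E → ℝ) (ν x : E) : hyper ν := (fderiv ℝ F x ν)⁻¹ • hproj ν (gradient F x)

theorem inner_gnomonic (ν x : E) (k : hyper ν) :
    ⟪gnomonic F ν x, k⟫ = (fderiv ℝ F x ν)⁻¹ * fderiv ℝ F x k := by
  rw [gnomonic, real_inner_smul_left, inner_hproj_left, inner_gradient_left]

theorem radial_gnomonic {ν x : E} (hν : ‖ν‖ = 1) (h : 0 < fderiv ℝ F x ν) :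
    radial ν (gnomonic F ν x) = ‖gradient F x‖⁻¹ • gradient F x := by
  have h1 : (gnomonic F ν x : E) + ν = (fderiv ℝ F x ν)⁻¹ • gradient F x := by
    rw [gnomonic, Submodule.coe_smul, coe_hproj hν, real_inner_comm, inner_gradient_left, smul_sub,
      smul_smul, inv_mul_cancel₀ h.ne', one_smul, sub_add_cancel]
  rw [radial, h1, norm_smul, Real.norm_eq_abs, abs_of_pos (inv_pos.2 h), smul_smul]
  congr 1
  rw [mul_inv, inv_inv]
  field_simp

theorem differentiableAt_gnomonic (hF : ContDiff ℝ (⊤ : ℕ∞) F) {ν x : E}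
    (h : fderiv ℝ F x ν ≠ 0) : DifferentiableAt ℝ (gnomonic F ν) x := by
  have hD : Differentiable ℝ (fderiv ℝ F) :=
    (hF.fderiv_right (m := ((1 : ℕ∞) : WithTop ℕ∞)) (by exact_mod_cast le_top)).differentiable (by simp)
  have hg : DifferentiableAt ℝ (gradient F) x :=
    ((InnerProductSpace.toDual ℝ E).symm.toContinuousLinearEquiv.differentiable _).comp x (hD x)
  have h1 : DifferentiableAt ℝ (fun z => fderiv ℝ F z ν) x :=
    (hD x).clm_apply (differentiableAt_const _)
  exact (h1.inv h).smul ((hproj ν).differentiableAt.comp x hg)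

theorem inner_fderiv_gnomonic (hF : ContDiff ℝ (⊤ : ℕ∞) F) {ν x : E}
    (h : fderiv ℝ F x ν ≠ 0) (w : E) (k : hyper ν) :
    ⟪fderiv ℝ (gnomonic F ν) x w, k⟫ =
      (fderiv ℝ F x ν)⁻¹ * fderiv ℝ (fderiv ℝ F) x w (tangentLift F ν x k) := by
  have hD : Differentiable ℝ (fderiv ℝ F) :=
    (hF.fderiv_right (m := ((1 : ℕ∞) : WithTop ℕ∞)) (by exact_mod_cast le_top)).differentiable (by simp)
  have happ : ∀ v : E, HasFDerivAt (fun z => fderiv ℝ F z v)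
      ((fderiv ℝ (fderiv ℝ F) x).flip v) x := fun v => by
    simpa using (hD x).hasFDerivAt.clm_apply (hasFDerivAt_const v x)
  have h1 := ((differentiableAt_gnomonic hF h).hasFDerivAt).inner ℝ (hasFDerivAt_const k x)
  simp only [inner_gnomonic] at h1
  have h2 := ((hasDerivAt_inv h).comp_hasFDerivAt x (happ ν)).mul (happ k)
  have h3 := congrArg (fun l => l w) (h1.unique h2)
  simp [fderivInnerCLM_apply] at h3
  rw [Submodule.coe_inner, h3, tangentLift_apply, map_sub, map_smul]
  simp
  field_simp
  ring

end Hyperplane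

section Patch

variable {d : ℕ} {K : Set (Euc d)} {F : Euc d → ℝ}

/-- The derivative of the normal direction in the graph chart over `hyper ν`. -/
def tangentHessian (F : Euc d → ℝ) (ν x : Euc d) : hyper ν →L[ℝ] hyper ν :=
  fderiv ℝ (gnomonic F ν) x ∘L tangentLift F ν x

theorem inner_tangentHessian (hF : ContDiff ℝ (⊤ : ℕ∞) F) {ν x : Euc d}
    (h : fderiv ℝ F x ν ≠ 0) (k k' : hyper ν) :
    ⟪tangentHessian F ν x k, k'⟫ = (fderiv ℝ F x ν)⁻¹ *
      fderiv ℝ (fderiv ℝ F) x (tangentLift F ν x k) (tangentLift F ν x k') :=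
  inner_fderiv_gnomonic hF h _ _

theorem inner_tangentHessian_self (hF : ContDiff ℝ (⊤ : ℕ∞) F) {ν x : Euc d}
    (h : fderiv ℝ F x ν ≠ 0) (k : hyper ν) :
    ⟪tangentHessian F ν x k, k⟫ = (fderiv ℝ F x ν)⁻¹ *
      iteratedFDeriv ℝ 2 F x (fun _ => tangentLift F ν x k) := by
  rw [inner_tangentHessian hF h, iteratedFDeriv_two_apply]

theorem SmoothBody.isPositive_tangentHessian (hK : SmoothBody d K F) {ν ζ : Euc d}
    (hζ : ζ ∈ frontier K) (h : 0 < fderiv ℝ F ζ ν) :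
    (tangentHessian F ν ζ : hyper ν →ₗ[ℝ] hyper ν).IsPositive := by
  refine ⟨fun k k' => ?_, fun k => ?_⟩
  · have hs : IsSymmSndFDerivAt ℝ F ζ := by
      refine hK.contDiff.contDiffAt.isSymmSndFDerivAt ?_
      simp only [minSmoothness_of_isRCLikeNormedField]
      exact WithTop.coe_le_coe.2 (le_top : (2 : ℕ∞) ≤ ⊤)
    rw [ContinuousLinearMap.coe_coe, real_inner_comm _ k, inner_tangentHessian hK.contDiff h.ne',
      inner_tangentHessian hK.contDiff h.ne', hs.eq]
  · rw [ContinuousLinearMap.coe_coe]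
    change 0 ≤ ⟪tangentHessian F ν ζ k, k⟫
    rw [inner_tangentHessian_self hK.contDiff h.ne']
    exact mul_nonneg (inv_pos.2 h).le (hK.hessian_nonneg hζ (fderiv_tangentLift h.ne' k))

theorem finrank_hyper {ν : Euc d} (hν : ‖ν‖ = 1) :
    (Module.finrank ℝ (hyper ν) : ℝ) = (d : ℝ) - 1 := by
  have h0 : ν ≠ 0 := norm_ne_zero_iff.1 (by simp [hν])
  have h := Submodule.finrank_add_finrank_orthogonal (ℝ ∙ ν)
  rw [finrank_span_singleton h0, finrank_euclideanSpace_fin] at h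
  have h' : (1 : ℝ) + Module.finrank ℝ (hyper ν) = d := by exact_mod_cast h
  linarith

/-- Quantitative control of `F` near a boundary point `ζ₀`, in the direction `ν`. -/
structure IsPatch (K : Set (Euc d)) (F : Euc d → ℝ) (ν ζ₀ : Euc d) (r γ L c : ℝ) : Prop where
  norm_eq : ‖ν‖ = 1
  r_pos : 0 < r
  γ_pos : 0 < γ
  L_nonneg : 0 ≤ L
  c_pos : 0 < c
  le_fderiv : ∀ z ∈ Metric.closedBall ζ₀ r, γ ≤ fderiv ℝ F z ν
  norm_fderiv_le : ∀ z ∈ Metric.closedBall ζ₀ 1, ‖fderiv ℝ F z‖ ≤ L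
  r_small : (2 + L / γ) * r ≤ 1
  hessian_le : ∀ ζ ∈ frontier K, ∀ w : Euc d, fderiv ℝ F ζ w = 0 → ‖w‖ ≤ (1 + L / γ) * r →
    ∀ b : ℝ, (∀ s ∈ Icc (0 : ℝ) 1, F (ζ + s • w) ≤ b) →
      c * iteratedFDeriv ℝ 2 F ζ (fun _ => w) ≤ b

theorem SmoothBody.exists_isPatch (hK : SmoothBody d K F) (hft : FiniteTypeAny d K F) {ζ₀ : Euc d}
    (hζ₀ : ζ₀ ∈ frontier K) : ∃ ν r γ L c, IsPatch K F ν ζ₀ r γ L c := by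
  obtain ⟨c, hc, ρ, hρ, hH⟩ := hK.exists_hessian_le hft
  have hfd : Continuous (fderiv ℝ F) := hK.contDiff.continuous_fderiv (by simp)
  obtain ⟨L, hL⟩ := (isCompact_closedBall ζ₀ 1).exists_bound_of_continuousOn hfd.continuousOn
  have hL0 : 0 ≤ L := (norm_nonneg _).trans (hL ζ₀ (Metric.mem_closedBall_self zero_le_one))
  set ν := nrml d F ζ₀ with hν
  have hg : 0 < ‖gradient F ζ₀‖ := norm_pos_iff.2 (hK.2.2.2.2.2.2 ζ₀ hζ₀)
  have hval : fderiv ℝ F ζ₀ ν = ‖gradient F ζ₀‖ := by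
    rw [hν, nrml, map_smul, ← inner_gradient_left, real_inner_self_eq_norm_sq, smul_eq_mul]
    field_simp
  set γ := ‖gradient F ζ₀‖ / 2 with hγ
  have hev : ∀ᶠ z in nhds ζ₀, γ < fderiv ℝ F z ν :=
    (hfd.clm_apply continuous_const).continuousAt.eventually (lt_mem_nhds (by
      change γ < fderiv ℝ F ζ₀ ν
      rw [hval]; linarith))
  obtain ⟨r₀, hr₀, hball⟩ := Metric.nhds_basis_closedBall.mem_iff.1 hev
  have hγ0 : 0 < γ := by positivity
  have hq : 0 ≤ L / γ := by positivity
  set r := min r₀ (min (1 / (2 + L / γ)) (ρ / (1 + L / γ)))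
  refine ⟨ν, r, γ, L, c, hK.norm_nrml hζ₀, by positivity, hγ0, hL0, hc, fun z hz => ?_, hL, ?_, ?_⟩
  · exact (hball (Metric.closedBall_subset_closedBall (min_le_left _ _) hz)).le
  · rw [mul_comm, ← le_div_iff₀ (by positivity)]
    exact (min_le_right _ _).trans (min_le_left _ _)
  · intro ζ hζ w hw hwr
    refine hH ζ hζ w hw (hwr.trans ?_)
    rw [mul_comm, ← le_div_iff₀ (by positivity)]
    exact (min_le_right _ _).trans (min_le_right _ _)

namespace IsPatch

variable {ν ζ₀ : Euc d} {r γ L c : ℝ}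

theorem r_le_one (P : IsPatch K F ν ζ₀ r γ L c) : r ≤ 1 := by
  have h1 : 0 ≤ L / γ := div_nonneg P.L_nonneg P.γ_pos.le
  nlinarith [P.r_small, P.r_pos, mul_nonneg h1 P.r_pos.le]

theorem norm_tangentLift_le (P : IsPatch K F ν ζ₀ r γ L c) {x : Euc d}
    (hx : x ∈ Metric.closedBall ζ₀ r) (k : hyper ν) :
    ‖tangentLift F ν x k‖ ≤ (1 + L / γ) * ‖k‖ := by
  have hg := P.le_fderiv x hx
  have hL := P.norm_fderiv_le x (Metric.closedBall_subset_closedBall P.r_le_one hx)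
  have hL0 := P.L_nonneg
  have hγ := P.γ_pos
  have h1 : ‖(fderiv ℝ F x ν)⁻¹ * fderiv ℝ F x k‖ ≤ γ⁻¹ * (L * ‖k‖) := by
    rw [norm_mul, norm_inv, Real.norm_of_nonneg (hγ.le.trans hg)]
    gcongr
    exact (fderiv ℝ F x).le_of_opNorm_le hL _
  calc _ ≤ ‖(k : Euc d)‖ + ‖((fderiv ℝ F x ν)⁻¹ * fderiv ℝ F x k) • ν‖ := by
        rw [tangentLift_apply]; exact norm_sub_le _ _
    _ ≤ ‖k‖ + γ⁻¹ * (L * ‖k‖) := by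
        rw [norm_smul, P.norm_eq, mul_one]; gcongr; exact le_rfl
    _ = _ := by ring

theorem inner_tangentHessian_le (hK : SmoothBody d K F) (P : IsPatch K F ν ζ₀ r γ L c)
    {ζ ξ : Euc d} {δ : ℝ} (hζ : ζ ∈ frontier K) (hζr : ζ ∈ Metric.closedBall ζ₀ (r / 2))
    (hξ : ξ ∈ cap d K F ζ δ) (hξr : ξ ∈ Metric.ball ζ (r / 2)) :
    ⟪tangentHessian F ν ζ (hproj ν (ξ - ζ)), hproj ν (ξ - ζ)⟫ ≤ L ^ 2 / (c * γ ^ 2) * δ := by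
  have hr := P.r_pos
  have hγ := P.γ_pos
  have hL0 := P.L_nonneg
  have hc := P.c_pos
  have hζ1 : ζ ∈ Metric.closedBall ζ₀ r := Metric.closedBall_subset_closedBall (by linarith) hζr
  have ha := P.le_fderiv ζ hζ1
  have hLζ := P.norm_fderiv_le ζ (Metric.closedBall_subset_closedBall P.r_le_one hζ1)
  set a := fderiv ℝ F ζ ν with hadef
  have ha0 : 0 < a := hγ.trans_le ha
  set u := ξ - ζ with hu
  set k := hproj ν u with hk
  set w := tangentLift F ν ζ k with hw
  have hξK : ξ ∈ K := hK.1.isClosed.frontier_subset hξ.1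
  have hζK : ζ ∈ K := hK.1.isClosed.frontier_subset hζ
  set s := -(a⁻¹ * fderiv ℝ F ζ u) with hs
  have hus : u = w - s • ν := by
    rw [hw, tangentLift_apply, hk, coe_hproj P.norm_eq, map_sub, map_smul, ← hadef, hs, smul_eq_mul,
      mul_sub, mul_comm (⟪ν, u⟫), ← mul_assoc, inv_mul_cancel₀ ha0.ne', sub_smul, neg_smul, one_mul]
    abel
  have hfu : fderiv ℝ F ζ u ≤ 0 := hK.fderiv_sub_nonpos hζ hξK
  have hs0 : 0 ≤ s := by
    rw [hs]; have := mul_nonneg (inv_pos.2 ha0).le (neg_nonneg.2 hfu); linarith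
  have hG : ‖gradient F ζ‖ ≤ L := by
    rwa [gradient, LinearIsometryEquiv.norm_map]
  have hG0 : 0 < ‖gradient F ζ‖ := norm_pos_iff.2 (hK.2.2.2.2.2.2 ζ hζ)
  have hsδ : s ≤ γ⁻¹ * (L * δ) := by
    have h1 := hξ.2
    rw [inner_nrml, abs_mul, abs_of_pos (inv_pos.2 hG0), inv_mul_lt_iff₀ hG0, ← hu] at h1
    have hδ : 0 < δ := (abs_nonneg _).trans_lt hξ.2
    have h2 : -fderiv ℝ F ζ u ≤ L * δ := (neg_le_abs _).trans (h1.le.trans (by gcongr))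
    rw [hs, ← mul_neg]
    gcongr
    linarith
  have hkn : ‖k‖ ≤ ‖u‖ := (hyper ν).norm_orthogonalProjectionOnto_apply_le u
  have hun : ‖u‖ ≤ r / 2 := by
    rw [hu, ← dist_eq_norm]; exact (Metric.mem_ball.1 hξr).le
  have hq : 0 ≤ L / γ := by positivity
  have hwn : ‖w‖ ≤ (1 + L / γ) * (r / 2) :=
    (P.norm_tangentLift_le hζ1 k).trans (by gcongr; exact hkn.trans hun)
  have hD : c * iteratedFDeriv ℝ 2 F ζ (fun _ => w) ≤ L * s := by
    refine P.hessian_le ζ hζ w (fderiv_tangentLift ha0.ne' k) (hwn.trans (by gcongr; linarith)) _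
      fun t ht => ?_
    have hmem : ∀ v : Euc d, ‖v‖ ≤ (1 + L / γ) * (r / 2) → ζ + t • v ∈ Metric.closedBall ζ₀ 1 := by
      intro v hv
      have h1 : ‖ζ - ζ₀‖ ≤ r / 2 := by rw [← dist_eq_norm]; exact hζr
      have h2 : ‖t • v‖ ≤ (1 + L / γ) * (r / 2) := by
        rw [norm_smul, Real.norm_of_nonneg ht.1]
        exact (mul_le_of_le_one_left (norm_nonneg _) ht.2).trans hv
      rw [Metric.mem_closedBall, dist_eq_norm, add_sub_right_comm]
      refine (norm_add_le _ _).trans ?_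
      have := P.r_small
      nlinarith
    have hlip := (convex_closedBall ζ₀ 1).norm_image_sub_le_of_norm_fderiv_le
      (fun z _ => hK.differentiable z) P.norm_fderiv_le
      (hmem u (hun.trans (by nlinarith))) (hmem w hwn)
    have hdiff : (ζ + t • w) - (ζ + t • u) = (t * s) • ν := by
      rw [hus, smul_sub, smul_smul]; abel
    rw [hdiff, norm_smul, P.norm_eq, mul_one, Real.norm_of_nonneg (mul_nonneg ht.1 hs0)] at hlip
    have hneg : F (ζ + t • u) ≤ 0 := hK.mem_iff.1 (hK.2.1.add_smul_sub_mem hζK hξK ht)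
    have h3 := (le_abs_self _).trans hlip
    have h4 : L * (t * s) ≤ L * s := by
      gcongr; exact mul_le_of_le_one_left hs0 ht.2
    linarith
  have hD0 := hK.hessian_nonneg hζ (fderiv_tangentLift ha0.ne' k)
  rw [inner_tangentHessian_self hK.contDiff ha0.ne']
  calc _ ≤ γ⁻¹ * iteratedFDeriv ℝ 2 F ζ (fun _ => w) := by gcongr
    _ ≤ γ⁻¹ * (L * s / c) := by
      gcongr; rw [le_div_iff₀ hc, mul_comm]; exact hD
    _ ≤ γ⁻¹ * (L * (γ⁻¹ * (L * δ)) / c) := by gcongr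
    _ = _ := by field_simp

end IsPatch

end Patch

section Measure

variable {d : ℕ} {K : Set (Euc d)} {F : Euc d → ℝ} {ν ζ₀ : Euc d} {r γ L c : ℝ}

theorem IsPatch.norm_sub_le (hK : SmoothBody d K F) (P : IsPatch K F ν ζ₀ r γ L c) {x y : Euc d}
    (hx : x ∈ frontier K ∩ Metric.closedBall ζ₀ r) (hy : y ∈ frontier K ∩ Metric.closedBall ζ₀ r) :
    ‖x - y‖ ≤ (1 + L / γ) * ‖hproj ν x - hproj ν y‖ := by
  rw [← map_sub]
  exact norm_sub_le_of_level hK.differentiable P.norm_eq (convex_closedBall ζ₀ r) P.γ_pos P.le_fderiv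
    (fun z hz => P.norm_fderiv_le z (Metric.closedBall_subset_closedBall P.r_le_one hz)) hx.2 hy.2
    ((hK.mem_frontier_iff.1 hx.1).trans (hK.mem_frontier_iff.1 hy.1).symm)

theorem IsPatch.exists_section (hK : SmoothBody d K F) (P : IsPatch K F ν ζ₀ r γ L c) :
    ∃ (C : NNReal) (ψ : hyper ν → Euc d),
      LipschitzOnWith C ψ (hproj ν '' (frontier K ∩ Metric.closedBall ζ₀ r)) ∧
        ∀ x ∈ frontier K ∩ Metric.closedBall ζ₀ r, ψ (hproj ν x) = x := by
  have hC : 0 ≤ 1 + L / γ := add_nonneg zero_le_one (div_nonneg P.L_nonneg P.γ_pos.le)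
  have hinj : InjOn (hproj ν) (frontier K ∩ Metric.closedBall ζ₀ r) := fun x hx y hy h => by
    have := P.norm_sub_le hK hx hy
    rw [h, sub_self, norm_zero, mul_zero] at this
    exact sub_eq_zero.1 (norm_le_zero_iff.1 this)
  have hψ := hinj.leftInvOn_invFunOn
  refine ⟨⟨_, hC⟩, _, LipschitzOnWith.of_dist_le_mul ?_, hψ⟩
  rintro _ ⟨x, hx, rfl⟩ _ ⟨y, hy, rfl⟩
  rw [hψ hx, hψ hy, dist_eq_norm, dist_eq_norm]
  exact P.norm_sub_le hK hx hy

theorem isAddHaarMeasure_hyper (hν : ‖ν‖ = 1) :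
    (μH[(d : ℝ) - 1] : Measure (hyper ν)).IsAddHaarMeasure := by
  rw [← finrank_hyper hν]
  infer_instance

theorem sub_one_nonneg_of_norm_eq_one (hν : ‖ν‖ = 1) : 0 ≤ (d : ℝ) - 1 := by
  rw [← finrank_hyper hν]
  positivity

theorem IsPatch.exists_hausdorffMeasure_le (hK : SmoothBody d K F)
    (P : IsPatch K F ν ζ₀ r γ L c) :
    ∃ C : NNReal, ∀ s ⊆ frontier K ∩ Metric.closedBall ζ₀ r,
      μH[(d : ℝ) - 1] s ≤ C * μH[(d : ℝ) - 1] (hproj ν '' s) := by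
  obtain ⟨C, ψ, hψ, hinv⟩ := P.exists_section hK
  have hd := sub_one_nonneg_of_norm_eq_one P.norm_eq
  refine ⟨C ^ ((d : ℝ) - 1), fun s hs => ?_⟩
  have him : ψ '' (hproj ν '' s) = s := by
    rw [image_image]
    exact (image_congr fun x hx => hinv x (hs hx)).trans (image_id' s)
  have h := (hψ.mono (image_mono hs)).hausdorffMeasure_image_le hd
  rwa [him, ← ENNReal.coe_rpow_of_nonneg _ hd] at h

theorem SmoothBody.hausdorffMeasure_frontier_lt_top (hK : SmoothBody d K F)
    (hft : FiniteTypeAny d K F) : μH[(d : ℝ) - 1] (frontier K) < ⊤ := by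
  refine hK.isCompact_frontier.measure_lt_top_of_nhdsWithin fun ζ₀ hζ₀ => ?_
  obtain ⟨ν, r, γ, L, c, P⟩ := hK.exists_isPatch hft hζ₀
  have := isAddHaarMeasure_hyper P.norm_eq
  obtain ⟨C, hC⟩ := P.exists_hausdorffMeasure_le hK
  refine ⟨frontier K ∩ Metric.closedBall ζ₀ r,
    inter_mem_nhdsWithin _ (Metric.closedBall_mem_nhds _ P.r_pos), (hC _ subset_rfl).trans_lt ?_⟩
  refine ENNReal.mul_lt_top ENNReal.coe_lt_top (IsCompact.measure_lt_top ?_)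
  exact (hK.isCompact_frontier.inter_right Metric.isClosed_closedBall).image (hproj ν).continuous

theorem IsPatch.exists_hausdorffMeasure_cap_le (hK : SmoothBody d K F)
    (P : IsPatch K F ν ζ₀ r γ L c) :
    ∃ C : ℝ, 0 ≤ C ∧ ∀ ζ ∈ frontier K ∩ Metric.closedBall ζ₀ (r / 2),
      (tangentHessian F ν ζ).det ≠ 0 → ∀ δ : ℝ, 0 ≤ δ → cap d K F ζ δ ⊆ Metric.ball ζ (r / 2) →
        (μH[(d : ℝ) - 1] (cap d K F ζ δ)).toReal ≤
          C * (√(tangentHessian F ν ζ).det)⁻¹ * √δ ^ Module.finrank ℝ (hyper ν) := by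
  have := isAddHaarMeasure_hyper P.norm_eq
  obtain ⟨C, hC⟩ := P.exists_hausdorffMeasure_le hK
  set μ : Measure (hyper ν) := μH[(d : ℝ) - 1] with hμ
  set n := Module.finrank ℝ (hyper ν) with hn
  set M := L ^ 2 / (c * γ ^ 2) with hM
  have hM0 : 0 ≤ M := by have := P.c_pos; have := P.γ_pos; positivity
  refine ⟨C * (√M ^ n * (μ (Metric.ball 0 1)).toReal), by positivity, fun ζ hζ hdet δ hδ hsub => ?_⟩
  have hζr : ζ ∈ Metric.closedBall ζ₀ r :=
    Metric.closedBall_subset_closedBall (by linarith [P.r_pos]) hζ.2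
  have hpos := hK.isPositive_tangentHessian hζ.1 (P.γ_pos.trans_le (P.le_fderiv ζ hζr))
  have hcapS : cap d K F ζ δ ⊆ frontier K ∩ Metric.closedBall ζ₀ r := fun ξ hξ => by
    refine ⟨hξ.1, ?_⟩
    have h1 := Metric.mem_ball.1 (hsub hξ)
    have h2 := Metric.mem_closedBall.1 hζ.2
    exact Metric.mem_closedBall.2 ((dist_triangle ξ ζ ζ₀).trans (by linarith))
  set Q : Set (hyper ν) := {k | ⟪(tangentHessian F ν ζ : hyper ν →ₗ[ℝ] hyper ν) k, k⟫ ≤ M * δ}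
    with hQ
  have him : hproj ν '' cap d K F ζ δ ⊆ (fun k => k + (-hproj ν ζ)) ⁻¹' Q := by
    rintro _ ⟨ξ, hξ, rfl⟩
    have h := P.inner_tangentHessian_le hK hζ.1 hζ.2 hξ (hsub hξ)
    rw [map_sub] at h
    simpa [hQ, ← sub_eq_add_neg] using h
  have hmeas : μ (hproj ν '' cap d K F ζ δ) ≤ μ Q :=
    (measure_mono him).trans_eq (measure_preimage_add_right μ _ _)
  have hQm := addHaar_quadratic_sublevel μ hpos hdet (ε := M * δ) (by positivity)
  have hle : μH[(d : ℝ) - 1] (cap d K F ζ δ) ≤ C * (ENNReal.ofReal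
      ((√(tangentHessian F ν ζ).det)⁻¹ * √(M * δ) ^ n) * μ (Metric.ball 0 1)) := by
    refine (hC _ hcapS).trans ?_
    gcongr
    exact hmeas.trans_eq hQm
  have hfin : μ (Metric.ball 0 1) ≠ ⊤ := measure_ball_lt_top.ne
  refine (ENNReal.toReal_mono (by finiteness) hle).trans_eq ?_
  rw [ENNReal.toReal_mul, ENNReal.toReal_mul, ENNReal.toReal_ofReal (by positivity),
    ENNReal.coe_toReal, Real.sqrt_mul hM0, mul_pow]
  ring

theorem capFn_nonneg (xi : Euc d → Euc d) (θ : Euc d) : 0 ≤ capFn d K F xi θ := by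
  refine Real.sSup_nonneg ?_
  rintro _ ⟨r, hr, rfl⟩
  positivity

theorem IsPatch.exists_capFn_le (hK : SmoothBody d K F) (hft : FiniteTypeAny d K F)
    (P : IsPatch K F ν ζ₀ r γ L c) :
    ∃ a b : ℝ, 0 ≤ a ∧ 0 ≤ b ∧ ∀ (xi : Euc d → Euc d) (θ : Euc d),
      xi θ ∈ frontier K ∩ Metric.closedBall ζ₀ (r / 2) → (tangentHessian F ν (xi θ)).det ≠ 0 →
        capFn d K F xi θ ≤ a + b * (√(tangentHessian F ν (xi θ)).det)⁻¹ := by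
  obtain ⟨C, hC0, hC⟩ := P.exists_hausdorffMeasure_cap_le hK
  obtain ⟨δ₀, hδ₀, hcap⟩ := hK.exists_cap_subset_ball hft (half_pos P.r_pos)
  set n := Module.finrank ℝ (hyper ν) with hn
  set δ₁ := min δ₀ 1 with hδ₁
  have hδ₁0 : 0 < δ₁ := by positivity
  set M := (μH[(d : ℝ) - 1] (frontier K)).toReal with hM
  refine ⟨M * √(1 + 1 / δ₁) ^ n, C * √2 ^ n, by positivity, by positivity, fun xi θ hθ hdet => ?_⟩
  refine Real.sSup_le ?_ (by positivity)
  rintro _ ⟨R, hR, rfl⟩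
  have hpow : (1 + R) ^ (((d : ℝ) - 1) / 2) = √(1 + R) ^ n := by
    rw [← finrank_hyper P.norm_eq, Real.rpow_div_two_eq_sqrt _ (by positivity), Real.rpow_natCast]
  rw [hpow]
  set T := (√(tangentHessian F ν (xi θ)).det)⁻¹ with hT
  have hT0 : 0 ≤ T := by positivity
  rcases le_or_gt δ₁ (1 / R) with h | h
  · have h1 : (μH[(d : ℝ) - 1] (cap d K F (xi θ) (1 / R))).toReal ≤ M :=
      ENNReal.toReal_mono (hK.hausdorffMeasure_frontier_lt_top hft).ne
        (measure_mono fun ξ hξ => hξ.1)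
    have h2 : R ≤ 1 / δ₁ := (le_one_div hδ₁0 hR).1 h
    calc _ ≤ M * √(1 + 1 / δ₁) ^ n := by gcongr
      _ ≤ _ := le_add_of_nonneg_right (by positivity)
  · have hR1 : 1 ≤ R := by
      have : 1 / R ≤ 1 := h.le.trans (min_le_right _ _)
      rwa [div_le_one hR] at this
    have hsub : cap d K F (xi θ) (1 / R) ⊆ Metric.ball (xi θ) (r / 2) :=
      fun ξ hξ =>
      hcap _ hθ.1 ⟨hξ.1, hξ.2.trans (h.trans_le (min_le_left _ _))⟩
    have h1 := hC _ hθ hdet (1 / R) (by positivity) hsub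
    calc _ ≤ C * T * √(1 / R) ^ n * √(1 + R) ^ n := by gcongr
      _ = C * T * √(1 / R * (1 + R)) ^ n := by
        rw [Real.sqrt_mul (by positivity), mul_pow]; ring
      _ ≤ C * T * √2 ^ n := by
        gcongr
        rw [one_div, inv_mul_le_iff₀ hR]; linarith
      _ = C * √2 ^ n * T := by ring
      _ ≤ _ := le_add_of_nonneg_left (by positivity)

theorem IsPatch.exists_capFn_rpow_le (hK : SmoothBody d K F) (hft : FiniteTypeAny d K F)
    (P : IsPatch K F ν ζ₀ r γ L c) {p : ℝ} (hp : 0 < p) (hp2 : p ≤ 2) :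
    ∃ a b : ℝ, 0 ≤ a ∧ 0 ≤ b ∧ ∀ (xi : Euc d → Euc d) (θ : Euc d),
      xi θ ∈ frontier K ∩ Metric.closedBall ζ₀ (r / 2) → (tangentHessian F ν (xi θ)).det ≠ 0 →
        capFn d K F xi θ ^ p ≤ a + b / |(tangentHessian F ν (xi θ)).det| := by
  obtain ⟨a, b, ha, hb, h⟩ := P.exists_capFn_le hK hft
  refine ⟨1 + 2 * a ^ 2, 2 * b ^ 2, by positivity, by positivity, fun xi θ hθ hdet => ?_⟩
  have h1 := h xi θ hθ hdet
  have h0 := capFn_nonneg (K := K) (F := F) xi θ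
  set Φ := capFn d K F xi θ
  have hΦ : Φ ^ p ≤ 1 + Φ ^ 2 := by
    rcases le_or_gt Φ 1 with hle | hgt
    · exact (Real.rpow_le_one h0 hle hp.le).trans (by nlinarith)
    · calc Φ ^ p ≤ Φ ^ (2 : ℝ) := Real.rpow_le_rpow_of_exponent_le hgt.le hp2
        _ = Φ ^ 2 := by norm_cast
        _ ≤ _ := by linarith
  have hsq : (√(tangentHessian F ν (xi θ)).det)⁻¹ ^ 2 ≤ |(tangentHessian F ν (xi θ)).det|⁻¹ := by
    rcases le_total (tangentHessian F ν (xi θ)).det 0 with hle | hge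
    · rw [Real.sqrt_eq_zero_of_nonpos hle]; simp
    · rw [inv_pow, Real.sq_sqrt hge, abs_of_nonneg hge]
  set T := (√(tangentHessian F ν (xi θ)).det)⁻¹
  have h2 : Φ ^ 2 ≤ (a + b * T) ^ 2 := pow_le_pow_left₀ h0 h1 2
  rw [div_eq_mul_inv]
  nlinarith [sq_nonneg (a - b * T), mul_le_mul_of_nonneg_left hsq (sq_nonneg b)]

end Measure

section Integral

variable {d : ℕ} {K : Set (Euc d)} {F : Euc d → ℝ} {ν ζ₀ : Euc d} {r γ L c : ℝ}

theorem IsPatch.lintegral_lt_top (hK : SmoothBody d K F) (hft : FiniteTypeAny d K F)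
    (P : IsPatch K F ν ζ₀ r γ L c) {xi : Euc d → Euc d}
    (hxi : ∀ z : Euc d, z ≠ 0 → xi z ∈ frontier K ∧ nrml d F (xi z) = ‖z‖⁻¹ • z)
    {p : ℝ} (hp : 0 < p) (hp2 : p ≤ 2) :
    ∫⁻ θ in {θ : Euc d | ‖θ‖ = 1 ∧ xi θ ∈ Metric.closedBall ζ₀ (r / 2)},
      ENNReal.ofReal (capFn d K F xi θ ^ p) ∂(μH[(d : ℝ) - 1]) < ⊤ := by
  have := isAddHaarMeasure_hyper P.norm_eq
  obtain ⟨a, b, ha, hb, hΦ⟩ := P.exists_capFn_rpow_le hK hft hp hp2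
  obtain ⟨C, ψ, hψ, hinv⟩ := P.exists_section hK
  set μ : Measure (hyper ν) := μH[(d : ℝ) - 1] with hμ
  set S := frontier K ∩ Metric.closedBall ζ₀ (r / 2) with hS
  set V := hproj ν '' S with hV
  have hSr : S ⊆ frontier K ∩ Metric.closedBall ζ₀ r :=
    inter_subset_inter_right _ (Metric.closedBall_subset_closedBall (by linarith [P.r_pos]))
  have hVc : IsCompact V :=
    (hK.isCompact_frontier.inter_right Metric.isClosed_closedBall).image (hproj ν).continuous
  have hψS : ∀ h ∈ V, ψ h ∈ S := by
    rintro _ ⟨x, hx, rfl⟩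
    rwa [hinv x (hSr hx)]
  have hprψ : ∀ h ∈ V, hproj ν (ψ h) = h := by
    rintro _ ⟨x, hx, rfl⟩
    rw [hinv x (hSr hx)]
  have hpos : ∀ h ∈ V, 0 < fderiv ℝ F (ψ h) ν := fun h hh =>
    P.γ_pos.trans_le (P.le_fderiv _ (hSr (hψS h hh)).2)
  set Y : hyper ν → hyper ν := fun h => gnomonic F ν (ψ h) with hY
  have hYd : ∀ h ∈ V, HasFDerivWithinAt Y (tangentHessian F ν (ψ h)) V h := fun h hh =>
    (differentiableAt_gnomonic hK.contDiff (hpos h hh).ne').hasFDerivAt.comp_hasFDerivWithinAt h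
      (hasFDerivWithinAt_section hK.differentiable P.norm_eq (hψ.mono (image_mono hSr))
        (fun h hh => hK.mem_frontier_iff.1 (hψS h hh).1) hprψ hh (hpos h hh).ne')
  have hrad : ∀ h ∈ V, radial ν (Y h) = nrml d F (ψ h) := fun h hh =>
    radial_gnomonic P.norm_eq (hpos h hh)
  have hYinj : InjOn Y V := fun h hh h' hh' heq => by
    have h1 := hK.eq_of_nrml_eq hft (hψS h hh).1 (hψS h' hh').1
      (by rw [← hrad h hh, ← hrad h' hh', heq])
    rw [← hprψ h hh, ← hprψ h' hh', h1]
  have hxiY : ∀ h ∈ V, xi (radial ν (Y h)) = ψ h := fun h hh => by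
    have hn : ‖radial ν (Y h)‖ = 1 := by rw [hrad h hh, hK.norm_nrml (hψS h hh).1]
    obtain ⟨h1, h2⟩ := hxi _ (norm_ne_zero_iff.1 (by rw [hn]; exact one_ne_zero))
    refine hK.eq_of_nrml_eq hft h1 (hψS h hh).1 ?_
    rw [h2, hn, inv_one, one_smul, hrad h hh]
  have hsub : {θ : Euc d | ‖θ‖ = 1 ∧ xi θ ∈ Metric.closedBall ζ₀ (r / 2)} ⊆
      radial ν '' (Y '' V) := by
    rintro θ ⟨hθ, hθr⟩
    obtain ⟨h1, h2⟩ := hxi θ (norm_ne_zero_iff.1 (by rw [hθ]; exact one_ne_zero))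
    have hmem : xi θ ∈ S := ⟨h1, hθr⟩
    refine ⟨_, ⟨_, ⟨xi θ, hmem, rfl⟩, rfl⟩, ?_⟩
    rw [hrad _ ⟨_, hmem, rfl⟩, hinv _ (hSr hmem), h2, hθ, inv_one, one_smul]
  set f : Euc d → ℝ≥0∞ := fun θ => ENNReal.ofReal (capFn d K F xi θ ^ p) with hf
  set A : ℝ≥0∞ := ENNReal.ofReal a with hA
  have hbound : ∀ h ∈ V, ENNReal.ofReal |(tangentHessian F ν (ψ h)).det| *
      (f (radial ν (Y h)) - A) ≤ ENNReal.ofReal b := by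
    intro h hh
    rcases eq_or_ne (tangentHessian F ν (ψ h)).det 0 with h0 | h0
    · simp [h0]
    have h1 := hΦ xi (radial ν (Y h)) (by rw [hxiY h hh]; exact hψS h hh) (by rwa [hxiY h hh])
    rw [hxiY h hh] at h1
    have hD : 0 < |(tangentHessian F ν (ψ h)).det| := abs_pos.2 h0
    have h2 : f (radial ν (Y h)) - A ≤
        ENNReal.ofReal (b / |(tangentHessian F ν (ψ h)).det|) := by
      rw [tsub_le_iff_left, hA, ← ENNReal.ofReal_add ha (by positivity)]
      exact ENNReal.ofReal_le_ofReal h1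
    calc _ ≤ _ := mul_le_mul_right h2 _
      _ = ENNReal.ofReal b := by
        rw [← ENNReal.ofReal_mul hD.le, mul_div_cancel₀ _ hD.ne']
  have hYV : IsCompact (Y '' V) := hVc.image_of_continuousOn fun h hh =>
    (hYd h hh).continuousWithinAt
  have hd := sub_one_nonneg_of_norm_eq_one P.norm_eq
  have hmain : ∫⁻ y in Y '' V, f (radial ν y) ∂μ < ⊤ := by
    calc ∫⁻ y in Y '' V, f (radial ν y) ∂μ
        ≤ ∫⁻ y in Y '' V, (A + (f (radial ν y) - A)) ∂μ :=
          lintegral_mono fun y => le_add_tsub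
      _ = A * μ (Y '' V) + ∫⁻ y in Y '' V, (f (radial ν y) - A) ∂μ := by
          rw [lintegral_add_left measurable_const, setLIntegral_const]
      _ = A * μ (Y '' V) + ∫⁻ h in V, ENNReal.ofReal |(tangentHessian F ν (ψ h)).det| *
            (f (radial ν (Y h)) - A) ∂μ := by
          rw [lintegral_image_eq_lintegral_abs_det_fderiv_mul μ hVc.measurableSet hYd hYinj]
      _ ≤ A * μ (Y '' V) + ∫⁻ _ in V, ENNReal.ofReal b ∂μ := by
          exact add_le_add le_rfl (setLIntegral_mono measurable_const hbound)
      _ < ⊤ := by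
          rw [setLIntegral_const]
          exact ENNReal.add_lt_top.2 ⟨ENNReal.mul_lt_top ENNReal.ofReal_lt_top hYV.measure_lt_top,
            ENNReal.mul_lt_top ENNReal.ofReal_lt_top hVc.measure_lt_top⟩
  calc _ ≤ ∫⁻ θ in radial ν '' (Y '' V), f θ ∂(μH[(d : ℝ) - 1]) := lintegral_mono_set hsub
    _ ≤ _ := lintegral_image_hausdorffMeasure_le (lipschitzWith_radial P.norm_eq) hd _ _
    _ < ⊤ := ENNReal.mul_lt_top (ENNReal.rpow_lt_top_of_nonneg hd ENNReal.coe_ne_top) hmain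

end Integral

/-- Corollary 2.1: for a smooth convex hypersurface of finite type, the cap function
`Φ` belongs to `L^p(S^{d−1})` for every `0 < p ≤ 2`. -/
theorem stmt6 (d : ℕ) (hd : 2 ≤ d) (K : Set (Euc d)) (F : Euc d → ℝ)
    (hK : SmoothBody d K F) (hft : FiniteTypeAny d K F)
    (xi : Euc d → Euc d)
    (hxi : ∀ z : Euc d, z ≠ 0 → xi z ∈ frontier K ∧ nrml d F (xi z) = ‖z‖⁻¹ • z) :
    ∀ p : ℝ, 0 < p → p ≤ 2 →
      ∫⁻ θ in {θ : Euc d | ‖θ‖ = 1}, ENNReal.ofReal (capFn d K F xi θ ^ p)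
        ∂(μH[(d : ℝ) - 1]) < ⊤ := by
  intro p hp hp2
  have hcover : ∫⁻ θ in {θ : Euc d | ‖θ‖ = 1 ∧ xi θ ∈ frontier K},
      ENNReal.ofReal (capFn d K F xi θ ^ p) ∂(μH[(d : ℝ) - 1]) < ⊤ := by
    refine hK.isCompact_frontier.induction_on
      (p := fun T => ∫⁻ θ in {θ : Euc d | ‖θ‖ = 1 ∧ xi θ ∈ T},
        ENNReal.ofReal (capFn d K F xi θ ^ p) ∂(μH[(d : ℝ) - 1]) < ⊤)
      (by simp) (fun s t hst ht => lt_of_le_of_lt (lintegral_mono_set ?_) ht)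
      (fun s t hs ht => ?_) (fun ζ₀ hζ₀ => ?_)
    · exact fun θ hθ => ⟨hθ.1, hst hθ.2⟩
    · refine lt_of_le_of_lt (lintegral_mono_set fun θ hθ => ?_)
        ((lintegral_union_le _ _ _).trans_lt (ENNReal.add_lt_top.2 ⟨hs, ht⟩))
      exact hθ.2.imp (fun h => ⟨hθ.1, h⟩) fun h => ⟨hθ.1, h⟩
    · obtain ⟨ν, r, γ, L, c, P⟩ := hK.exists_isPatch hft hζ₀
      exact ⟨_, mem_nhdsWithin_of_mem_nhds (Metric.closedBall_mem_nhds ζ₀ (half_pos P.r_pos)),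
        P.lintegral_lt_top hK hft hxi hp hp2⟩
  refine lt_of_le_of_lt (lintegral_mono_set fun θ hθ => ?_) hcover
  refine ⟨hθ, (hxi θ ?_).1⟩
  rintro rfl
  simp at hθ
end
end

section
/- Let Σ = ∂K be the boundary of a compact convex body K ⊂ ℝ^d (d ≥ 2) with smooth boundary, and suppose Σ is of finite type k ≥ 2. Then there is a constant C = C(Σ) > 0 such that for every 0 < s ≤ 1, every y ∈ ℝ^d with |y| < s, and every x ∈ ℝ^d with |x| ≥ 2s, one has ξ(x−y) ∈ B(ξ(x), C/|x|), where ξ(z) is the point of Σ whose outer unit normal is z/|z|. -/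
open MeasureTheory Set
open scoped RealInnerProductSpace ENNReal

noncomputable section

/-- The gradient of a differentiable function at a maximizer over a convex set supports the set. -/
lemma inner_gradient_sub_nonpos {d : ℕ} {K : Set (Euc d)} {F : Euc d → ℝ} {ζ η : Euc d}
    (hconv : Convex ℝ K) (hF : DifferentiableAt ℝ F ζ) (hmax : IsMaxOn F K ζ)
    (hζ : ζ ∈ K) (hη : η ∈ K) : ⟪gradient F ζ, η - ζ⟫ ≤ 0 :=
  hmax.localize.hasFDerivWithinAt_nonpos hF.hasGradientAt.hasFDerivAt.hasFDerivWithinAt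
    (sub_mem_posTangentConeAt_of_segment_subset (hconv.segment_subset hζ hη))

/-- Lemma 2.2: if `|y| < s ≤ 1` and `|x| ≥ 2s`, then `ξ(x−y) ∈ B(ξ(x), C/|x|)`,
where `ξ(z)` is the point of `Σ` whose outer unit normal is `z/|z|`. -/
theorem stmt7 (d k : ℕ) (hd : 2 ≤ d) (hk : 2 ≤ k) (K : Set (Euc d)) (F : Euc d → ℝ)
    (hK : SmoothBody d K F) (hft : FiniteTypeOrd d k K F)
    (xi : Euc d → Euc d)
    (hxi : ∀ z : Euc d, z ≠ 0 → xi z ∈ frontier K ∧ nrml d F (xi z) = ‖z‖⁻¹ • z) :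
    ∃ C : ℝ, 0 < C ∧ ∀ s : ℝ, 0 < s → s ≤ 1 →
      ∀ y : Euc d, ‖y‖ < s → ∀ x : Euc d, 2 * s ≤ ‖x‖ →
        xi (x - y) ∈ cap d K F (xi x) (C / ‖x‖) := by
  obtain ⟨hcomp, hconv, -, hsm, hKF, hfr, -⟩ := hK
  have hfrK : frontier K ⊆ K := hcomp.isClosed.frontier_subset
  have hsupp : ∀ z : Euc d, z ≠ 0 → ∀ η ∈ K, ⟪z, η - xi z⟫ ≤ 0 := by
    intro z hz η hη
    obtain ⟨hmem, hn⟩ := hxi z hz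
    have hmax : IsMaxOn F K (xi z) := by
      intro w hw
      have h0 : F (xi z) = 0 := by rw [hfr] at hmem; exact hmem
      have hw' : F w ≤ 0 := by rw [hKF] at hw; exact hw
      simpa [h0] using hw'
    have hgrad := inner_gradient_sub_nonpos hconv
      ((hsm.differentiable (by simp)) (xi z)) hmax (hfrK hmem) hη
    have hdir : ⟪‖z‖⁻¹ • z, η - xi z⟫ ≤ 0 := by
      rw [← hn, nrml, real_inner_smul_left]
      exact mul_nonpos_of_nonneg_of_nonpos (by positivity) hgrad
    rw [real_inner_smul_left] at hdir
    exact nonpos_of_mul_nonpos_right hdir (inv_pos.mpr (norm_pos_iff.mpr hz))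
  refine ⟨Metric.diam K + 1, by positivity, fun s hs hs1 y hy x hx => ?_⟩
  have hx0 : 0 < ‖x‖ := by linarith
  have hxne : x ≠ 0 := norm_pos_iff.mp hx0
  have hxy : x - y ≠ 0 := by
    intro h
    rw [sub_eq_zero.mp h] at hx
    linarith
  obtain ⟨hm, hn⟩ := hxi x hxne
  have hm' := (hxi (x - y) hxy).1
  refine ⟨hm', ?_⟩
  have h1 := hsupp x hxne _ (hfrK hm')
  have h2 := hsupp (x - y) hxy _ (hfrK hm)
  have h3 : ⟪y, xi x - xi (x - y)⟫ ≤ Metric.diam K := by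
    calc ⟪y, xi x - xi (x - y)⟫ ≤ ‖y‖ * ‖xi x - xi (x - y)‖ := real_inner_le_norm _ _
      _ ≤ 1 * Metric.diam K := by
        gcongr
        · linarith
        · rw [← dist_eq_norm]
          exact Metric.dist_le_diam_of_mem hcomp.isBounded (hfrK hm) (hfrK hm')
      _ = Metric.diam K := one_mul _
  rw [hn, real_inner_smul_left, abs_mul, abs_of_nonneg (inv_nonneg.mpr hx0.le),
    abs_of_nonpos h1, div_eq_inv_mul]
  gcongr
  simp only [inner_sub_left, inner_sub_right] at h1 h2 h3 ⊢
  linarith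
end
end

section
/- Let 0 < p < 1 and let Ω be a measurable subset of ℝ^d. Suppose (h_k)_{k∈ℕ} is a sequence of nonnegative measurable functions on Ω and A > 0 is a constant such that |{x ∈ Ω : h_k(x) > λ}| ≤ A λ^{−p} for every k and every λ > 0. If (a_k)_{k∈ℕ} is a sequence of positive numbers with ∑_k a_k^p < ∞, then for every λ > 0, |{x ∈ Ω : ∑_k a_k h_k(x) > λ}| ≤ ((2−p)/(1−p)) (∑_k a_k^p) A λ^{−p}. -/
open MeasureTheory Set
open scoped ENNReal

noncomputable section

/-- A nonnegative function of weak type `p < 1` has integrable truncations, with the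
explicit bound obtained from the layer cake formula. -/
theorem lintegral_min_le_of_weak_type {α : Type*} [MeasurableSpace α] {μ : Measure α}
    {p C lam : ℝ} (hp : p < 1) (hC : 0 ≤ C) (hlam : 0 < lam)
    {g : α → ℝ} (hg : Measurable g) (hg0 : 0 ≤ᵐ[μ] g)
    (hweak : ∀ t : ℝ, 0 < t → μ {x | t < g x} ≤ ENNReal.ofReal (C * t ^ (-p))) :
    ∫⁻ x, ENNReal.ofReal (min (g x) lam) ∂μ ≤
      ENNReal.ofReal (C * (lam ^ (1 - p) / (1 - p))) := by
  have hint : IntervalIntegrable (fun t : ℝ => C * t ^ (-p)) volume 0 lam :=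
    (intervalIntegral.intervalIntegrable_rpow' (by linarith)).const_mul C
  have hval : ∫ t in Ioc 0 lam, C * t ^ (-p) = C * (lam ^ (1 - p) / (1 - p)) := by
    rw [← intervalIntegral.integral_of_le hlam.le, intervalIntegral.integral_const_mul,
      integral_rpow (Or.inl (by linarith)), show -p + 1 = 1 - p by ring,
      Real.zero_rpow (by linarith), sub_zero]
  have hmin0 : 0 ≤ᵐ[μ] fun x => min (g x) lam := by
    filter_upwards [hg0] with x hx using le_min hx hlam.le
  rw [lintegral_eq_lintegral_meas_lt μ hmin0 (hg.min measurable_const).aemeasurable, ← hval,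
    ofReal_integral_eq_lintegral_ofReal
      ((intervalIntegrable_iff_integrableOn_Ioc_of_le hlam.le).1 hint)
      ((ae_restrict_iff' measurableSet_Ioc).2 (.of_forall fun t ht =>
        mul_nonneg hC (Real.rpow_nonneg ht.1.le _))),
    ← lintegral_indicator measurableSet_Ioi, ← lintegral_indicator measurableSet_Ioc]
  refine lintegral_mono fun t => ?_
  by_cases ht : 0 < t
  · rw [indicator_of_mem (mem_Ioi.2 ht)]
    by_cases htl : t ≤ lam
    · rw [indicator_of_mem (mem_Ioc.2 ⟨ht, htl⟩)]
      have hsub : {x | t < min (g x) lam} ⊆ {x | t < g x} := fun x hx =>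
        (show t < min (g x) lam from hx).trans_le (min_le_left _ _)
      exact (measure_mono hsub).trans (hweak t ht)
    · have : {x | t < min (g x) lam} = ∅ :=
        eq_empty_of_forall_notMem fun x hx => htl (lt_min_iff.1 hx).2.le
      rw [this, measure_empty]
      exact zero_le
  · rw [indicator_of_notMem (by simpa using ht)]
    exact zero_le

/-- If a series of extended nonnegative numbers exceeds a threshold, so does, weakly, the series
truncated at that threshold. -/
theorem ENNReal.le_tsum_min_of_lt_tsum {ι : Type*} {f : ι → ℝ≥0∞} {c : ℝ≥0∞}
    (hc : c < ∑' i, f i) : c ≤ ∑' i, min (f i) c := by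
  by_cases hex : ∃ i, c < f i
  · obtain ⟨i, hi⟩ := hex
    calc c = min (f i) c := (min_eq_right hi.le).symm
      _ ≤ ∑' i, min (f i) c := ENNReal.le_tsum i
  · push Not at hex
    simpa only [min_eq_left (hex _)] using hc.le

/-- Lemma 4.1 (Stein–Taibleson–Weiss): summing weak type functions for `0 < p < 1`.
The (possibly infinite) sum `∑ a_k h_k(x)` is taken in `ℝ≥0∞` via `ENNReal.ofReal`
of the nonnegative terms, so that divergence is handled correctly. -/
theorem stmt11 (d : ℕ) (p : ℝ) (hp1 : 0 < p) (hp2 : p < 1)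
    (Ω : Set (Euc d)) (hΩ : MeasurableSet Ω)
    (h : ℕ → Euc d → ℝ) (hmeas : ∀ k, Measurable (h k))
    (hnn : ∀ k, ∀ x ∈ Ω, 0 ≤ h k x)
    (A : ℝ) (hA : 0 < A)
    (hweak : ∀ k : ℕ, ∀ lam : ℝ, 0 < lam →
      volume {x ∈ Ω | lam < h k x} ≤ ENNReal.ofReal (A / lam ^ p))
    (a : ℕ → ℝ) (ha : ∀ k, 0 < a k) (hsum : Summable fun k => a k ^ p) :
    ∀ lam : ℝ, 0 < lam →
      volume {x ∈ Ω | ENNReal.ofReal lam < ∑' k : ℕ, ENNReal.ofReal (a k * h k x)} ≤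
        ENNReal.ofReal ((2 - p) / (1 - p) * (∑' k : ℕ, a k ^ p) * (A / lam ^ p)) := by
  intro lam hlam
  have hg : ∀ k, Measurable fun x => a k * h k x := fun k => (hmeas k).const_mul _
  have hbound : ∀ k, ∫⁻ x in Ω, ENNReal.ofReal (min (a k * h k x) lam) ≤
      ENNReal.ofReal (A * a k ^ p * (lam ^ (1 - p) / (1 - p))) := fun k => by
    refine lintegral_min_le_of_weak_type hp2
      (mul_nonneg hA.le (Real.rpow_nonneg (ha k).le _)) hlam (hg k)
      ((ae_restrict_iff' hΩ).2 (.of_forall fun x hx => mul_nonneg (ha k).le (hnn k x hx))) ?_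
    intro t ht
    have hset : {x | t < a k * h k x} ∩ Ω = {x ∈ Ω | t / a k < h k x} := by
      ext x
      simp [div_lt_iff₀' (ha k), and_comm]
    rw [Measure.restrict_apply (measurableSet_lt measurable_const (hg k)), hset]
    refine (hweak k _ (div_pos ht (ha k))).trans_eq ?_
    rw [Real.div_rpow ht.le (ha k).le, Real.rpow_neg ht.le, div_div_eq_mul_div,
      ← div_eq_mul_inv]
  have hSnn : 0 ≤ ∑' k, a k ^ p := tsum_nonneg fun k => Real.rpow_nonneg (ha k).le _
  have hlint : ∫⁻ x in Ω, ∑' k, ENNReal.ofReal (min (a k * h k x) lam) ≤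
      ENNReal.ofReal (A * (∑' k, a k ^ p) * (lam ^ (1 - p) / (1 - p))) := by
    rw [lintegral_tsum fun k => ((hg k).min measurable_const).ennreal_ofReal.aemeasurable]
    refine (ENNReal.tsum_le_tsum hbound).trans_eq ?_
    rw [← tsum_mul_left, ← tsum_mul_right, ENNReal.ofReal_tsum_of_nonneg]
    · intro k
      have := Real.rpow_nonneg (ha k).le p
      have := sub_pos.2 hp2
      positivity
    · exact (hsum.mul_left A).mul_right _
  have hsub : {x ∈ Ω | ENNReal.ofReal lam < ∑' k : ℕ, ENNReal.ofReal (a k * h k x)} ⊆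
      {x | ENNReal.ofReal lam ≤ ∑' k, ENNReal.ofReal (min (a k * h k x) lam)} ∩ Ω := by
    rintro x ⟨hxΩ, hx⟩
    refine ⟨?_, hxΩ⟩
    simpa only [mem_ofPred_eq, ENNReal.ofReal_min] using ENNReal.le_tsum_min_of_lt_tsum hx
  have hmeasF : Measurable fun x => ∑' k, ENNReal.ofReal (min (a k * h k x) lam) :=
    Measurable.tsum fun k => ((hg k).min measurable_const).ennreal_ofReal
  calc volume {x ∈ Ω | ENNReal.ofReal lam < ∑' k : ℕ, ENNReal.ofReal (a k * h k x)}
      ≤ volume.restrict Ω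
          {x | ENNReal.ofReal lam ≤ ∑' k, ENNReal.ofReal (min (a k * h k x) lam)} := by
        rw [Measure.restrict_apply (measurableSet_le measurable_const hmeasF)]
        exact measure_mono hsub
    _ ≤ (∫⁻ x in Ω, ∑' k, ENNReal.ofReal (min (a k * h k x) lam)) / ENNReal.ofReal lam :=
        meas_ge_le_lintegral_div hmeasF.aemeasurable (by simpa using hlam) ENNReal.ofReal_ne_top
    _ ≤ ENNReal.ofReal (A * (∑' k, a k ^ p) * (lam ^ (1 - p) / (1 - p)) / lam) := by
        rw [ENNReal.ofReal_div_of_pos hlam]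
        gcongr
    _ ≤ ENNReal.ofReal ((2 - p) / (1 - p) * (∑' k : ℕ, a k ^ p) * (A / lam ^ p)) := by
        refine ENNReal.ofReal_le_ofReal ?_
        have h1p : 0 < 1 - p := sub_pos.2 hp2
        have hlp : 0 < lam ^ p := Real.rpow_pos_of_pos hlam p
        calc A * (∑' k, a k ^ p) * (lam ^ (1 - p) / (1 - p)) / lam
            = 1 / (1 - p) * (∑' k, a k ^ p) * (A / lam ^ p) := by
              rw [Real.rpow_sub hlam, Real.rpow_one]
              field_simp
          _ ≤ (2 - p) / (1 - p) * (∑' k, a k ^ p) * (A / lam ^ p) := by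
              gcongr
              linarith
end
end

section
/- Let a > 0, 0 < p < 1, and let Ω be a measurable subset of ℝ^d. Suppose (g_l)_{l∈ℕ} is a sequence of measurable functions on Ω and B > 0 is a constant such that |{x ∈ Ω : |g_l(x)| > λ}| ≤ B 2^{−a l p} λ^{−p} for every l ∈ ℕ and every λ > 0. Then there is a constant C = C(a,p) > 0 such that for every λ > 0, |{x ∈ Ω : ∑_{l∈ℕ} |g_l(x)| > λ}| ≤ C B λ^{−p}. -/
open MeasureTheory Set
open scoped ENNReal

noncomputable section

/-- If a series of nonnegative reals `s l` sums to `t`, the superlevel set `{∑ |g l| > t}` is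
covered by the superlevel sets `{|g l| > s l}`. -/
theorem superlevel_tsum_subset_iUnion {α : Type*} (Ω : Set α) (g : ℕ → α → ℝ) {s : ℕ → ℝ} {t : ℝ}
    (hs0 : ∀ l, 0 ≤ s l) (hs : HasSum s t) :
    {x ∈ Ω | ENNReal.ofReal t < ∑' l : ℕ, ENNReal.ofReal |g l x|} ⊆
      ⋃ l, {x ∈ Ω | s l < |g l x|} := by
  rintro x ⟨hxΩ, hx⟩
  by_contra hcon
  simp only [mem_iUnion, mem_ofPred_eq, not_exists, not_and, not_lt] at hcon
  refine hx.not_ge ?_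
  rw [← hs.tsum_eq, ENNReal.ofReal_tsum_of_nonneg hs0 hs.summable]
  exact ENNReal.tsum_le_tsum fun l => ENNReal.ofReal_le_ofReal (hcon l hxΩ)

/-- Dividing the weight `2 ^ (-(a l p))` by the `p`-th power of a level decaying like
`2 ^ (-(a / 2) l)` leaves a geometric sequence of ratio `2 ^ (-(a * p / 2))`. -/
theorem two_rpow_div_level_rpow (a p B : ℝ) (l : ℕ) {t c : ℝ} (ht : 0 < t) (hc : 0 < c) :
    B * 2 ^ (-(a * l * p)) / (t * c * ((2 : ℝ) ^ (-(a / 2))) ^ l) ^ p =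
      B / t ^ p / c ^ p * ((2 : ℝ) ^ (-(a * p / 2))) ^ l := by
  have htp : 0 < t ^ p := Real.rpow_pos_of_pos ht p
  have hcp : 0 < c ^ p := Real.rpow_pos_of_pos hc p
  rw [Real.mul_rpow (by positivity) (by positivity), Real.mul_rpow ht.le hc.le,
    ← Real.rpow_mul_natCast (by norm_num), ← Real.rpow_mul_natCast (by norm_num),
    ← Real.rpow_mul (by norm_num)]
  have h : (2 : ℝ) ^ (-(a * l * p)) = 2 ^ (-(a * p / 2) * l) * 2 ^ (-(a / 2) * l * p) := by
    rw [← Real.rpow_add (by norm_num)]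
    ring_nf
  have hpos : (0 : ℝ) < 2 ^ (-(a / 2) * l * p) := by positivity
  rw [h]
  field_simp

/-- Lemma 4.2: if `|{|g_l| > λ}| ≤ B 2^{−alp} λ^{−p}` for all `l ∈ ℕ` and `λ > 0`,
then `|{∑_l |g_l| > λ}| ≤ C B λ^{−p}` with `C = C(a,p)`.  The (possibly infinite)
sum `∑_l |g_l(x)|` is taken in `ℝ≥0∞`. -/
theorem stmt12 (d : ℕ) (a p : ℝ) (ha : 0 < a) (hp1 : 0 < p) (hp2 : p < 1) :
    ∃ C : ℝ, 0 < C ∧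
      ∀ Ω : Set (Euc d), MeasurableSet Ω →
      ∀ g : ℕ → Euc d → ℝ, (∀ l, Measurable (g l)) →
      ∀ B : ℝ, 0 < B →
      (∀ l : ℕ, ∀ lam : ℝ, 0 < lam →
        volume {x ∈ Ω | lam < |g l x|} ≤
          ENNReal.ofReal (B * 2 ^ (-(a * l * p)) / lam ^ p)) →
      ∀ lam : ℝ, 0 < lam →
        volume {x ∈ Ω | ENNReal.ofReal lam < ∑' l : ℕ, ENNReal.ofReal |g l x|} ≤
          ENNReal.ofReal (C * B / lam ^ p) := by
  have hr0 : (0 : ℝ) < 2 ^ (-(a / 2)) := by positivity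
  have hr1 : (2 : ℝ) ^ (-(a / 2)) < 1 :=
    Real.rpow_lt_one_of_one_lt_of_neg (by norm_num) (by linarith)
  have hq0 : (0 : ℝ) < 2 ^ (-(a * p / 2)) := by positivity
  have hq1 : (2 : ℝ) ^ (-(a * p / 2)) < 1 :=
    Real.rpow_lt_one_of_one_lt_of_neg (by norm_num) (by linarith [mul_pos ha hp1])
  have hc : (0 : ℝ) < 1 - 2 ^ (-(a / 2)) := by linarith
  have hcp := Real.rpow_pos_of_pos hc p
  have hq : (0 : ℝ) < 1 - 2 ^ (-(a * p / 2)) := by linarith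
  refine ⟨((1 - (2 : ℝ) ^ (-(a / 2))) ^ p)⁻¹ * (1 - (2 : ℝ) ^ (-(a * p / 2)))⁻¹,
    by positivity, ?_⟩
  intro Ω _ g _ B hB hg lam hlam
  have hlp : 0 < lam ^ p := Real.rpow_pos_of_pos hlam p
  have hlevel : HasSum
      (fun l : ℕ => lam * (1 - (2 : ℝ) ^ (-(a / 2))) * ((2 : ℝ) ^ (-(a / 2))) ^ l) lam := by
    have h := (hasSum_geometric_of_lt_one hr0.le hr1).mul_left
      (lam * (1 - (2 : ℝ) ^ (-(a / 2))))
    rwa [mul_inv_cancel_right₀ hc.ne'] at h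
  have hbound := (hasSum_geometric_of_lt_one hq0.le hq1).mul_left
    (B / lam ^ p / (1 - (2 : ℝ) ^ (-(a / 2))) ^ p)
  calc _ ≤ volume (⋃ l : ℕ, {x ∈ Ω |
          lam * (1 - (2 : ℝ) ^ (-(a / 2))) * ((2 : ℝ) ^ (-(a / 2))) ^ l < |g l x|}) :=
        measure_mono (superlevel_tsum_subset_iUnion Ω g (fun l => by positivity) hlevel)
    _ ≤ ∑' l : ℕ, ENNReal.ofReal (B / lam ^ p / (1 - (2 : ℝ) ^ (-(a / 2))) ^ p *
          ((2 : ℝ) ^ (-(a * p / 2))) ^ l) := by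
        refine (measure_iUnion_le _).trans (ENNReal.tsum_le_tsum fun l => ?_)
        rw [← two_rpow_div_level_rpow a p B l hlam hc]
        exact hg l _ (by positivity)
    _ = _ := by
        rw [← ENNReal.ofReal_tsum_of_nonneg (fun l => by positivity) hbound.summable,
          hbound.tsum_eq]
        congr 1
        field_simp
end
end
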